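/- arXiv:2308.07740 — 2 statements merged into one kernel-verified Lean document; each statement's English description precedes it below -/
import Mathlib

section
/- Let d ≥ 1, let k be an integer with 2 ≤ k ≤ 5, and let s ∈ ℝ. There exist constants c, δ, K > 0, depending only on d, k, s, such that for all A ≥ 1, all N ≥ A/δ, all R > 0, all t with K/N ≤ t ≤ δ, and φ the function with φ̂ = R·𝟙_{Ω_k}, setting φ⃗ := (φ,0), one has ‖Ξ₁(φ⃗)(t)‖_{H^s(ℝ^d)} ≥ c R^k (t/N) A^{(k−1)d} · min( g_s(A), g_s(1/t) ). -/
open MeasureTheory Real Set Filter Topology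
open scoped ENNReal NNReal BigOperators

noncomputable section

/-- Frequency space `ℝ^d` with the Euclidean norm. -/
abbrev Edim (d : ℕ) := EuclideanSpace ℝ (Fin d)

/-! We work entirely on the Fourier side: a function `f` on `ℝ^d` is represented by
its Fourier transform `F = f̂ : ℝ^d → ℂ`. -/

/-- Squared `H^s` norm, computed on the Fourier side:
`‖f‖_{H^s}² = ∫ ⟨ξ⟩^{2s} |f̂(ξ)|² dξ`. -/
def HsNormSq (d : ℕ) (s : ℝ) (F : Edim d → ℂ) : ℝ≥0∞ :=
  ∫⁻ ξ, ENNReal.ofReal ((1 + ‖ξ‖ ^ 2) ^ s * ‖F ξ‖ ^ 2)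

/-- `H^s` norm on the Fourier side. -/
def HsNorm (d : ℕ) (s : ℝ) (F : Edim d → ℂ) : ℝ≥0∞ :=
  HsNormSq d s F ^ (1 / 2 : ℝ)

/-- Norm of `𝓗^s = H^s × H^{s-1}` on the Fourier side. -/
def pairHsNorm (d : ℕ) (s : ℝ) (F G : Edim d → ℂ) : ℝ≥0∞ :=
  (HsNormSq d s F + HsNormSq d (s - 1) G) ^ (1 / 2 : ℝ)

/-- Membership in `H^s`, on the Fourier side. -/
def MemHs (d : ℕ) (s : ℝ) (F : Edim d → ℂ) : Prop :=
  Measurable F ∧ HsNormSq d s F < ⊤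

/-- Membership in `𝓗^s = H^s × H^{s-1}`, on the Fourier side. -/
def MemHsPair (d : ℕ) (s : ℝ) (F G : Edim d → ℂ) : Prop :=
  MemHs d s F ∧ MemHs d (s - 1) G

/-- The Wiener-algebra norm `‖f‖_{FL^{0,1}} = ‖f̂‖_{L¹}`, on the Fourier side. -/
def FLNorm (d : ℕ) (F : Edim d → ℂ) : ℝ≥0∞ :=
  ∫⁻ ξ, (‖F ξ‖₊ : ℝ≥0∞)

/-- The norm `‖g‖_{FL^{-1,1}} = ‖⟨ξ⟩⁻¹ ĝ‖_{L¹}`, on the Fourier side. -/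
def FLm1Norm (d : ℕ) (F : Edim d → ℂ) : ℝ≥0∞ :=
  ∫⁻ ξ, ENNReal.ofReal ((1 + ‖ξ‖ ^ 2) ^ (-(1 : ℝ) / 2) * ‖F ξ‖)

/-- Norm of `F⃗L¹ = FL^{0,1} × FL^{-1,1}`. -/
def pairFLNorm (d : ℕ) (F G : Edim d → ℂ) : ℝ≥0∞ :=
  FLNorm d F + FLm1Norm d G

/-- Membership in `F⃗L¹ = FL^{0,1} × FL^{-1,1}`, on the Fourier side. -/
def MemFLPair (d : ℕ) (F G : Edim d → ℂ) : Prop :=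
  Measurable F ∧ Measurable G ∧ pairFLNorm d F G < ⊤

/-- Symbol of `V₀(t)`: `cos((√3/2)|ξ|t) + (1/√3) sin((√3/2)|ξ|t)`. -/
def V0sym (t r : ℝ) : ℝ :=
  Real.cos (Real.sqrt 3 / 2 * r * t) + 1 / Real.sqrt 3 * Real.sin (Real.sqrt 3 / 2 * r * t)

/-- Symbol of `V₁(t)`: `sin((√3/2)|ξ|t) / ((√3/2)|ξ|)`. -/
def V1sym (t r : ℝ) : ℝ :=
  Real.sin (Real.sqrt 3 / 2 * r * t) / (Real.sqrt 3 / 2 * r)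

/-- Symbol of the Poisson kernel `P(t)`: `e^{-|ξ|t/2}`. -/
def Psym (t r : ℝ) : ℝ := Real.exp (-(r * t) / 2)

/-- Symbol of `W(t) = P(t)V₁(t)`. -/
def Wsym (t r : ℝ) : ℝ := Psym t r * V1sym t r

/-- Fourier side of the linear flow `V(t)(u₀,u₁) = P(t)(V₀(t)u₀ + V₁(t)u₁)`. -/
def Vflow (d : ℕ) (F₀ F₁ : Edim d → ℂ) (t : ℝ) (ξ : Edim d) : ℂ :=
  ((Psym t ‖ξ‖ * V0sym t ‖ξ‖ : ℝ) : ℂ) * F₀ ξ + ((Psym t ‖ξ‖ * V1sym t ‖ξ‖ : ℝ) : ℂ) * F₁ ξ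

/-- Convolution on `ℝ^d`. -/
def conv (d : ℕ) (f g : Edim d → ℂ) (ξ : Edim d) : ℂ :=
  ∫ η, f (ξ - η) * g η

/-- `convIter d f n` is the `(n+1)`-fold convolution `f ∗ ⋯ ∗ f`. -/
def convIter (d : ℕ) (f : Edim d → ℂ) : ℕ → Edim d → ℂ
  | 0 => f
  | n + 1 => conv d (convIter d f n) f

/-- Convolution of a (nonempty) list of functions. -/
def listConv (d : ℕ) : List (Edim d → ℂ) → Edim d → ℂ
  | [] => fun _ => 0
  | f :: fs => fs.foldl (conv d) f

/-- Fourier side of the Duhamel operator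
`I_k(u₁,…,u_k)(t) = -∫₀ᵗ W(t-t') ∏ u_j(t') dt'`. -/
def Ik (d k : ℕ) (us : Fin k → ℝ → Edim d → ℂ) (t : ℝ) (ξ : Edim d) : ℂ :=
  -(∫ t' in (0 : ℝ)..t,
      ((Wsym (t - t') ‖ξ‖ : ℝ) : ℂ) * listConv d (List.ofFn fun i => us i t') ξ)

/-- Picard iterates `Ξ_j` of vNLW, on the Fourier side:
`Ξ₀(u⃗₀)(t) = V(t)u⃗₀` and
`Ξ_j(u⃗₀) = ∑_{j₁+⋯+j_k = j-1} I_k(Ξ_{j₁}(u⃗₀),…,Ξ_{j_k}(u⃗₀))`. -/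
def Xi (d k : ℕ) (F₀ F₁ : Edim d → ℂ) : ℕ → ℝ → Edim d → ℂ
  | 0 => Vflow d F₀ F₁
  | j + 1 => fun t ξ =>
      ∑ l ∈ (Finset.Nat.antidiagonalTuple k j).attach,
        Ik d k (fun i => Xi d k F₀ F₁ (l.1 i)) t ξ
  decreasing_by
    have h := Finset.Nat.mem_antidiagonalTuple.mp l.2
    have hle := Finset.single_le_sum (f := l.1) (fun j _ => Nat.zero_le (l.1 j))
      (Finset.mem_univ i)
    omega

/-- `u : [0,T] → FL^{0,1}(ℝ^d)` (represented on the Fourier side) is a Duhamel solution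
of vNLW with nonlinearity `-u^k` and initial data `(u₀,u₁)` with `û₀ = F₀`, `û₁ = F₁`. -/
structure IsDuhamelSolution (d k : ℕ) (T : ℝ) (F₀ F₁ : Edim d → ℂ)
    (u : ℝ → Edim d → ℂ) : Prop where
  measurable : ∀ t ∈ Set.Icc (0 : ℝ) T, Measurable (u t)
  finite : ∀ t ∈ Set.Icc (0 : ℝ) T, FLNorm d (u t) < ⊤
  continuous : ∀ t₀ ∈ Set.Icc (0 : ℝ) T, ∀ ε : ℝ, 0 < ε → ∃ δ : ℝ, 0 < δ ∧
    ∀ t ∈ Set.Icc (0 : ℝ) T, |t - t₀| < δ →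
      FLNorm d (fun ξ => u t ξ - u t₀ ξ) < ENNReal.ofReal ε
  duhamel : ∀ t ∈ Set.Icc (0 : ℝ) T, ∀ᵐ ξ : Edim d, u t ξ =
    ((Psym t ‖ξ‖ * V0sym t ‖ξ‖ : ℝ) : ℂ) * F₀ ξ
      + ((Psym t ‖ξ‖ * V1sym t ‖ξ‖ : ℝ) : ℂ) * F₁ ξ
      - ∫ t' in (0 : ℝ)..t,
          ((Wsym (t - t') ‖ξ‖ : ℝ) : ℂ) * convIter d (u t') (k - 1) ξ

/-- The cube `Q_A = [-A/8, A/8]^d`. -/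
def cubeSet (d : ℕ) (A : ℝ) : Set (Edim d) := {ξ | ∀ i, |ξ i| ≤ A / 8}

/-- `Ω = ⋃_{η ∈ Σ} (η + Q_A)` with `Σ = {-2Ne₁, -Ne₁, Ne₁, 2Ne₁}`. -/
def OmegaSet (d : ℕ) (N A : ℝ) : Set (Edim d) :=
  {ξ | ∃ c : ℝ, (c = -2 * N ∨ c = -N ∨ c = N ∨ c = 2 * N) ∧
    ∀ i : Fin d, |ξ i - (if (i : ℕ) = 0 then c else 0)| ≤ A / 8}

/-- `Ω_k = ⋃_{η ∈ Σ_k} (η + Q_A)` with `Σ_k = {-Ne₁, Ne₁}` for even `k` and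
`Σ_k = {-2Ne₁, -Ne₁, Ne₁, 2Ne₁}` for odd `k`. -/
def OmegaKSet (d k : ℕ) (N A : ℝ) : Set (Edim d) :=
  {ξ | ∃ c : ℝ, (if k % 2 = 0 then c = -N ∨ c = N
      else c = -2 * N ∨ c = -N ∨ c = N ∨ c = 2 * N) ∧
    ∀ i : Fin d, |ξ i - (if (i : ℕ) = 0 then c else 0)| ≤ A / 8}

/-- `φ̂ = R·𝟙_Ω`. -/
def phiHat (d : ℕ) (N A R : ℝ) : Edim d → ℂ :=
  Set.indicator (OmegaSet d N A) fun _ => (R : ℂ)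

/-- `φ̂ = R·𝟙_{Ω_k}`. -/
def phiHatK (d k : ℕ) (N A R : ℝ) : Edim d → ℂ :=
  Set.indicator (OmegaKSet d k N A) fun _ => (R : ℂ)

/-- `g_s(A)`: `1` if `s < -d/2`; `(log⟨A⟩)^{1/2}` if `s = -d/2`; `A^{d/2+s}` if `s > -d/2`. -/
def gs (d : ℕ) (s A : ℝ) : ℝ :=
  if s < -(d : ℝ) / 2 then 1
  else if s = -(d : ℝ) / 2 then Real.sqrt (Real.log (Real.sqrt (1 + A ^ 2)))
  else A ^ ((d : ℝ) / 2 + s)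

/-- The profile `h` for which `P(t)V₀(t)` has symbol `h(|ξ|t)`: the solution of
`∂²h + ∂h + h = 0` with `h(0) = 1`, `∂h(0) = 0`. -/
def prof (τ : ℝ) : ℝ :=
  exp (-τ / 2) * (cos (√3 / 2 * τ) + 1 / √3 * sin (√3 / 2 * τ))

/-- The derivative of `prof`. -/
def prof' (τ : ℝ) : ℝ := -(2 / √3) * (exp (-τ / 2) * sin (√3 / 2 * τ))

lemma Psym_mul_V0sym (t r : ℝ) : Psym t r * V0sym t r = prof (r * t) := by
  simp only [Psym, V0sym, prof, mul_assoc]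

lemma sqrt_three_mul_self : √3 * √3 = (3 : ℝ) := Real.mul_self_sqrt (by norm_num)

lemma one_div_sqrt_three : 1 / √3 = √3 / 3 := by
  rw [div_eq_div_iff (by positivity) (by norm_num), sqrt_three_mul_self, one_mul]

lemma two_div_sqrt_three : 2 / √3 = 2 / 3 * √3 := by
  rw [show 2 / √3 = 2 * (1 / √3) by ring, one_div_sqrt_three]; ring

lemma sqrt_three_le_two : √3 ≤ 2 := by
  rw [Real.sqrt_le_left (by norm_num)]; norm_num

lemma hasDerivAt_exp_half (τ : ℝ) :
    HasDerivAt (fun τ : ℝ => exp (-τ / 2)) (exp (-τ / 2) * (-1 / 2)) τ :=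
  (((hasDerivAt_id τ).neg).div_const 2).exp

lemma hasDerivAt_prof (τ : ℝ) : HasDerivAt prof (prof' τ) τ := by
  have h1 : HasDerivAt (fun τ : ℝ => √3 / 2 * τ) (√3 / 2) τ := by
    simpa using (hasDerivAt_id τ).const_mul (√3 / 2)
  refine ((hasDerivAt_exp_half τ).mul (h1.cos.add (h1.sin.const_mul (1 / √3)))).congr_deriv ?_
  simp only [Pi.add_apply, prof', two_div_sqrt_three, one_div_sqrt_three]
  linear_combination (exp (-τ / 2) * cos (√3 / 2 * τ) / 6) * sqrt_three_mul_self

lemma hasDerivAt_prof' (τ : ℝ) : HasDerivAt prof' (-prof τ - prof' τ) τ := by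
  have h1 : HasDerivAt (fun τ : ℝ => √3 / 2 * τ) (√3 / 2) τ := by
    simpa using (hasDerivAt_id τ).const_mul (√3 / 2)
  refine (((hasDerivAt_exp_half τ).mul h1.sin).const_mul (-(2 / √3))).congr_deriv ?_
  simp only [prof', prof, two_div_sqrt_three, one_div_sqrt_three]
  linear_combination (-exp (-τ / 2) * cos (√3 / 2 * τ) / 3) * sqrt_three_mul_self

lemma prof_two_mul (τ : ℝ) : prof (2 * τ) = prof τ ^ 2 - prof' τ ^ 2 := by
  have he : exp (-(2 * τ) / 2) = exp (-τ / 2) ^ 2 := by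
    rw [← Real.exp_nat_mul]; congr 1; push_cast; ring
  simp only [prof, prof', two_div_sqrt_three, one_div_sqrt_three, he,
    show √3 / 2 * (2 * τ) = 2 * (√3 / 2 * τ) by ring, Real.cos_two_mul', Real.sin_two_mul]
  linear_combination (exp (-τ / 2) ^ 2 * sin (√3 / 2 * τ) ^ 2 / 3) * sqrt_three_mul_self

lemma continuous_prof : Continuous prof :=
  continuous_iff_continuousAt.2 fun τ => (hasDerivAt_prof τ).continuousAt

lemma abs_prof_le (τ : ℝ) : |prof τ| ≤ 2 * exp (-τ / 2) := by
  rw [prof, abs_mul, abs_of_pos (exp_pos _), mul_comm]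
  gcongr
  have h1 := abs_cos_le_one (√3 / 2 * τ)
  have h2 := abs_sin_le_one (√3 / 2 * τ)
  have h3 : |1 / √3 * sin (√3 / 2 * τ)| ≤ 1 := by
    rw [one_div_sqrt_three, abs_mul, abs_of_nonneg (by positivity)]
    have := sqrt_three_le_two
    nlinarith [abs_nonneg (sin (√3 / 2 * τ))]
  exact (abs_add_le _ _).trans (by linarith)

lemma abs_prof'_le (τ : ℝ) : |prof' τ| ≤ 2 * exp (-τ / 2) := by
  rw [prof', abs_mul, abs_mul, abs_neg, abs_of_pos (exp_pos _), two_div_sqrt_three,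
    abs_of_nonneg (by positivity)]
  have h2 := abs_sin_le_one (√3 / 2 * τ)
  have := sqrt_three_le_two
  have h4 : exp (-τ / 2) * |sin (√3 / 2 * τ)| ≤ exp (-τ / 2) :=
    mul_le_of_le_one_right (exp_pos _).le h2
  have := exp_pos (-τ / 2)
  calc 2 / 3 * √3 * (exp (-τ / 2) * |sin (√3 / 2 * τ)|) ≤ 2 * exp (-τ / 2) := by
        gcongr; linarith

lemma abs_prof_sub_le {ρ x y : ℝ} (hx : ρ ≤ x) (hy : ρ ≤ y) :
    |prof x - prof y| ≤ 2 * exp (-ρ / 2) * |x - y| := by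
  refine (convex_Ici ρ).norm_image_sub_le_of_norm_hasDerivWithin_le (f := prof) (f' := prof')
    (fun z _ => (hasDerivAt_prof z).hasDerivWithinAt) (fun z hz => ?_) hy hx
  refine (abs_prof'_le z).trans ?_
  have : ρ ≤ z := hz
  gcongr

lemma tendsto_exp_half : Tendsto (fun τ : ℝ => 2 * exp (-τ / 2)) atTop (𝓝 0) := by
  have : Tendsto (fun τ : ℝ => -τ / 2) atTop atBot :=
    tendsto_neg_atTop_atBot.atBot_div_const (by norm_num)
  simpa using (Real.tendsto_exp_atBot.comp this).const_mul 2

lemma tendsto_prof : Tendsto prof atTop (𝓝 0) :=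
  squeeze_zero_norm abs_prof_le tendsto_exp_half

lemma tendsto_prof' : Tendsto prof' atTop (𝓝 0) :=
  squeeze_zero_norm abs_prof'_le tendsto_exp_half

/-- The set of integers `m` such that `m N e₁` is a centre of a cube of `Ω_k`. -/
def centers (k : ℕ) : Finset ℤ := if k % 2 = 0 then {-1, 1} else {-2, -1, 1, 2}

/-- Weight at `m` of the `(n+1)`-fold convolution power of `∑_{c ∈ S} a(c) δ_c` on `ℤ`. -/
def convWeight (S : Finset ℤ) (a : ℤ → ℝ) : ℕ → ℤ → ℝ
  | 0, m => if m ∈ S then a m else 0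
  | n + 1, m => ∑ c ∈ S, a c * convWeight S a n (m - c)

/-- Amplitude at rescaled time `τ` of the zero-frequency interaction. -/
def resonance (k : ℕ) (τ : ℝ) : ℝ :=
  convWeight (centers k) (fun c => prof (|(c : ℝ)| * τ)) (k - 1) 0

lemma card_centers_le (k : ℕ) : (centers k).card ≤ 4 := by
  unfold centers; split_ifs <;> decide

lemma continuous_convWeight (S : Finset ℤ) (a : ℝ → ℤ → ℝ)
    (ha : ∀ c, Continuous fun τ => a τ c) (n : ℕ) (m : ℤ) :
    Continuous fun τ => convWeight S (a τ) n m := by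
  induction n generalizing m with
  | zero =>
    simp only [convWeight]
    split_ifs
    · exact ha m
    · exact continuous_const
  | succ n ih =>
    simp only [convWeight]
    exact continuous_finsetSum _ fun c _ => (ha c).mul (ih _)

lemma abs_convWeight_le (S : Finset ℤ) (a : ℤ → ℝ) {M : ℝ}
    (ha : ∀ c ∈ S, |a c| ≤ M) (n : ℕ) (m : ℤ) (hM : 0 ≤ M) :
    |convWeight S a n m| ≤ (S.card : ℝ) ^ n * M ^ (n + 1) := by
  induction n generalizing m with
  | zero =>
    simp only [convWeight]
    split_ifs with h
    · simpa using ha m h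
    · simpa using hM
  | succ n ih =>
    simp only [convWeight]
    calc |∑ c ∈ S, a c * convWeight S a n (m - c)|
        ≤ ∑ c ∈ S, |a c * convWeight S a n (m - c)| := Finset.abs_sum_le_sum_abs _ _
      _ ≤ ∑ c ∈ S, M * ((S.card : ℝ) ^ n * M ^ (n + 1)) := by
          refine Finset.sum_le_sum fun c hc => ?_
          rw [abs_mul]
          exact mul_le_mul (ha c hc) (ih _) (abs_nonneg _) hM
      _ = _ := by rw [Finset.sum_const, nsmul_eq_mul]; ring

lemma convWeight_const_mul (S : Finset ℤ) (a : ℤ → ℝ) (R : ℝ) (n : ℕ) (m : ℤ) :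
    convWeight S (fun c => R * a c) n m = R ^ (n + 1) * convWeight S a n m := by
  induction n generalizing m with
  | zero => simp [convWeight]
  | succ n ih =>
    simp only [convWeight, ih, Finset.mul_sum]
    exact Finset.sum_congr rfl fun c _ => by ring

lemma continuous_resonance (k : ℕ) : Continuous (resonance k) :=
  continuous_convWeight _ (fun τ c => prof (|(c : ℝ)| * τ))
    (fun _ => continuous_prof.comp (continuous_const.mul continuous_id)) _ _

lemma one_le_abs_of_mem_centers {k : ℕ} {c : ℤ} (hc : c ∈ centers k) : 1 ≤ |(c : ℝ)| := by
  unfold centers at hc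
  split_ifs at hc <;> simp only [Finset.mem_insert, Finset.mem_singleton] at hc
  · rcases hc with rfl | rfl <;> norm_num
  · rcases hc with rfl | rfl | rfl | rfl <;> norm_num

lemma abs_resonance_le {k : ℕ} (hk : 1 ≤ k) {τ : ℝ} (hτ : 0 ≤ τ) :
    |resonance k τ| ≤ 8 ^ k * exp (-τ / 2) := by
  have h := abs_convWeight_le (centers k) (fun c => prof (|(c : ℝ)| * τ))
    (M := 2 * exp (-τ / 2)) (fun c hc => (abs_prof_le _).trans ?_) (k - 1) 0 (by positivity)
  · refine h.trans ?_
    have h1 : exp (-τ / 2) ≤ 1 := exp_le_one_iff.2 (by linarith)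
    have hc : ((centers k).card : ℝ) ≤ 4 := by exact_mod_cast card_centers_le k
    obtain ⟨n, rfl⟩ : ∃ n, k = n + 1 := ⟨k - 1, by omega⟩
    rw [Nat.add_sub_cancel, mul_pow, show (8 : ℝ) = 4 * 2 by norm_num, mul_pow]
    have h2 : exp (-τ / 2) ^ (n + 1) ≤ exp (-τ / 2) :=
      pow_le_of_le_one (exp_pos _).le h1 (by omega)
    have h3 : ((centers (n + 1)).card : ℝ) ^ n ≤ 4 ^ (n + 1) :=
      (pow_le_pow_left₀ (by positivity) hc n).trans
        (pow_le_pow_right₀ (by norm_num) (by omega))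
    rw [mul_assoc]
    gcongr
  · have := one_le_abs_of_mem_centers hc
    have : τ ≤ |(c : ℝ)| * τ := by nlinarith
    gcongr

lemma resonance_two (τ : ℝ) : resonance 2 τ = 2 * prof τ ^ 2 := by
  simp [resonance, centers, convWeight]; ring

lemma resonance_three (τ : ℝ) : resonance 3 τ = 6 * prof (2 * τ) * prof τ ^ 2 := by
  simp [resonance, centers, convWeight]; ring_nf

lemma resonance_four (τ : ℝ) : resonance 4 τ = 6 * prof τ ^ 4 := by
  simp [resonance, centers, convWeight]; ring

lemma resonance_five (τ : ℝ) : resonance 5 τ =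
    40 * prof (2 * τ) * prof τ ^ 4 + 60 * prof (2 * τ) ^ 3 * prof τ ^ 2 := by
  simp [resonance, centers, convWeight]; ring_nf

lemma tendsto_integral_of_hasDerivAt {p P : ℝ → ℝ} (hP : ∀ τ, HasDerivAt P (p τ) τ)
    (hp : Continuous p) (h0 : Tendsto P atTop (𝓝 0)) :
    Tendsto (fun T => ∫ τ in (0 : ℝ)..T, p τ) atTop (𝓝 (-P 0)) := by
  have h : (fun T => ∫ τ in (0 : ℝ)..T, p τ) = fun T => P T - P 0 := by
    ext T
    exact intervalIntegral.integral_eq_sub_of_hasDerivAt (fun τ _ => hP τ)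
      (hp.intervalIntegrable _ _)
  rw [h]
  simpa using h0.sub_const (P 0)

lemma prof_zero : prof 0 = 1 := by simp [prof]

lemma prof'_zero : prof' 0 = 0 := by simp [prof']

lemma hasDerivAt_prof_pow_mul (i j : ℕ) (τ : ℝ) :
    HasDerivAt (fun τ => prof τ ^ i * prof' τ ^ j)
      (i * prof τ ^ (i - 1) * prof' τ * prof' τ ^ j
        + prof τ ^ i * (j * prof' τ ^ (j - 1) * (-prof τ - prof' τ))) τ :=
  ((hasDerivAt_prof τ).fun_pow i).fun_mul ((hasDerivAt_prof' τ).fun_pow j)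

lemma tendsto_prof_pow_mul {i j : ℕ} (hij : i + j ≠ 0) :
    Tendsto (fun τ => prof τ ^ i * prof' τ ^ j) atTop (𝓝 0) := by
  have h := (tendsto_prof.pow i).mul (tendsto_prof'.pow j)
  rwa [← pow_add, zero_pow hij] at h

/-- A homogeneous form of degree `n` in `prof` and `prof'` with coefficients `c`. -/
def profForm (n : ℕ) (c : ℕ → ℝ) (τ : ℝ) : ℝ :=
  ∑ j ∈ Finset.range (n + 1), c j * (prof τ ^ (n - j) * prof' τ ^ j)

lemma tendsto_profForm {n : ℕ} (hn : n ≠ 0) (c : ℕ → ℝ) :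
    Tendsto (profForm n c) atTop (𝓝 0) := by
  have h := tendsto_finsetSum (Finset.range (n + 1)) fun j (_ : j ∈ Finset.range (n + 1)) =>
    (tendsto_prof_pow_mul (i := n - j) (j := j) (by omega)).const_mul (c j)
  simp only [mul_zero, Finset.sum_const_zero] at h
  exact h

lemma hasDerivAt_profForm (n : ℕ) (c : ℕ → ℝ) (τ : ℝ) :
    HasDerivAt (profForm n c)
      (∑ j ∈ Finset.range (n + 1), c j *
        ((n - j : ℕ) * prof τ ^ (n - j - 1) * prof' τ * prof' τ ^ j
        + prof τ ^ (n - j) * (j * prof' τ ^ (j - 1) * (-prof τ - prof' τ)))) τ :=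
  HasDerivAt.fun_sum fun j _ => (hasDerivAt_prof_pow_mul (n - j) j τ).const_mul (c j)

lemma profForm_zero (n : ℕ) (c : ℕ → ℝ) : profForm n c 0 = c 0 := by
  rw [profForm, Finset.sum_eq_single 0]
  · simp [prof_zero]
  · intro j _ hj
    simp [prof'_zero, hj]
  · simp

lemma tendsto_integral_resonance {k : ℕ} (hk2 : 2 ≤ k) (hk5 : k ≤ 5) :
    ∃ I : ℝ, I ≠ 0 ∧ Tendsto (fun T => ∫ τ in (0 : ℝ)..T, resonance k τ) atTop (𝓝 I) := by
  suffices h : ∃ P : ℝ → ℝ, P 0 ≠ 0 ∧ Tendsto P atTop (𝓝 0) ∧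
      ∀ τ, HasDerivAt P (resonance k τ) τ by
    obtain ⟨P, h0, hP, hd⟩ := h
    exact ⟨-P 0, neg_ne_zero.2 h0,
      tendsto_integral_of_hasDerivAt hd (continuous_resonance k) hP⟩
  interval_cases k
  · refine ⟨profForm 2 fun j => [-2, -2, -1].getD j 0,
      by rw [profForm_zero]; norm_num, tendsto_profForm (by norm_num) _,
      fun τ => (hasDerivAt_profForm 2 _ τ).congr_deriv ?_⟩
    rw [resonance_two]
    simp [Finset.sum_range_succ]
    ring
  · refine ⟨profForm 4 fun j => [-45/14, -6, -24/7, -12/7, -3/7].getD j 0,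
      by rw [profForm_zero]; norm_num, tendsto_profForm (by norm_num) _,
      fun τ => (hasDerivAt_profForm 4 _ τ).congr_deriv ?_⟩
    rw [resonance_three, prof_two_mul]
    simp [Finset.sum_range_succ]
    ring
  · refine ⟨profForm 4 fun j => [-57/14, -6, -36/7, -18/7, -9/14].getD j 0,
      by rw [profForm_zero]; norm_num, tendsto_profForm (by norm_num) _,
      fun τ => (hasDerivAt_profForm 4 _ τ).congr_deriv ?_⟩
    rw [resonance_four]
    simp [Finset.sum_range_succ]
    ring
  · refine ⟨fun τ => profForm 6 (fun j =>
        [-3580/189, -40, -2320/63, -5440/189, -320/21, -320/63, -160/189].getD j 0) τ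
      + profForm 8 (fun j => [-123945/5719, -60, -324210/5719, -241380/5719, -305280/5719,
        -203040/5719, -34320/5719, -8580/5719, -2145/11438].getD j 0) τ,
      by beta_reduce; rw [profForm_zero, profForm_zero]; norm_num, ?_,
      fun τ => ((hasDerivAt_profForm 6 _ τ).fun_add (hasDerivAt_profForm 8 _ τ)).congr_deriv ?_⟩
    · simpa only [add_zero] using
        (tendsto_profForm (by norm_num) _).add (tendsto_profForm (by norm_num) _)
    · rw [resonance_five, prof_two_mul]
      simp [Finset.sum_range_succ]
      ring

section Convolution

variable {d : ℕ} {S : Set (Edim d)} {v : ℝ}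

lemma norm_conv_le {F f : Edim d → ℂ} {M L : ℝ} (hS : volume S < ⊤) (hv : volume.real S ≤ v)
    (hF : ∀ ξ, ‖F ξ‖ ≤ M) (hf : ∀ η, ‖f η‖ ≤ L) (hfS : ∀ η, η ∉ S → f η = 0) (ξ : Edim d) :
    ‖conv d F f ξ‖ ≤ M * L * v := by
  have hM : 0 ≤ M := (norm_nonneg _).trans (hF 0)
  have hL : 0 ≤ L := (norm_nonneg _).trans (hf 0)
  rw [conv, ← setIntegral_eq_integral_of_forall_compl_eq_zero (s := S)
    fun η hη => by rw [hfS η hη, mul_zero]]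
  refine (norm_setIntegral_le_of_norm_le_const (C := M * L) hS fun η _ => ?_).trans (by gcongr)
  rw [norm_mul]
  exact mul_le_mul (hF _) (hf _) (norm_nonneg _) hM

lemma integrable_conv {F f : Edim d → ℂ} {M L : ℝ} (hS : volume S < ⊤)
    (hFm : Measurable F) (hfm : Measurable f)
    (hF : ∀ ξ, ‖F ξ‖ ≤ M) (hf : ∀ η, ‖f η‖ ≤ L) (hfS : ∀ η, η ∉ S → f η = 0) (ξ : Edim d) :
    Integrable fun η => F (ξ - η) * f η := by
  have hM : 0 ≤ M := (norm_nonneg _).trans (hF 0)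
  rw [← integrableOn_iff_integrable_of_support_subset (s := S)]
  · refine Measure.integrableOn_of_bounded (M := M * L) hS.ne ?_ (ae_of_all _ fun η => ?_)
    · exact ((hFm.comp (measurable_const.sub measurable_id)).mul hfm).aestronglyMeasurable
    · rw [norm_mul]
      exact mul_le_mul (hF _) (hf _) (norm_nonneg _) hM
  · intro η hη
    by_contra h
    exact hη (by simp [hfS η h])

lemma measurable_conv_uncurry {α : Type*} [MeasurableSpace α] {F f : α → Edim d → ℂ}
    (hF : Measurable (Function.uncurry F)) (hf : Measurable (Function.uncurry f)) :
    Measurable (Function.uncurry fun a => conv d (F a) (f a)) := by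
  have h : Measurable (Function.uncurry fun (p : α × Edim d) (η : Edim d) =>
      F p.1 (p.2 - η) * f p.1 η) := by
    have h1 : Measurable fun q : (α × Edim d) × Edim d => (q.1.1, q.1.2 - q.2) := by fun_prop
    have h2 : Measurable fun q : (α × Edim d) × Edim d => (q.1.1, q.2) := by fun_prop
    exact (hF.comp h1).mul (hf.comp h2)
  exact h.stronglyMeasurable.integral_prod_right.measurable

lemma measurable_convIter_uncurry {α : Type*} [MeasurableSpace α] {f : α → Edim d → ℂ}
    (hf : Measurable (Function.uncurry f)) (n : ℕ) :
    Measurable (Function.uncurry fun a => convIter d (f a) n) := by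
  induction n with
  | zero => exact hf
  | succ n ih => exact measurable_conv_uncurry ih hf

lemma measurable_convIter {f : Edim d → ℂ} (hf : Measurable f) (n : ℕ) :
    Measurable (convIter d f n) :=
  (measurable_convIter_uncurry (α := Unit) (f := fun _ => f)
    (hf.comp measurable_snd) n).of_uncurry_left (x := ())

lemma norm_convIter_le {f : Edim d → ℂ} {M : ℝ} (hS : volume S < ⊤) (hv : volume.real S ≤ v)
    (hf : ∀ η, ‖f η‖ ≤ M) (hfS : ∀ η, η ∉ S → f η = 0) (n : ℕ) (ξ : Edim d) :
    ‖convIter d f n ξ‖ ≤ M ^ (n + 1) * v ^ n := by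
  induction n generalizing ξ with
  | zero => simpa [convIter] using hf ξ
  | succ n ih => exact (norm_conv_le hS hv ih hf hfS ξ).trans_eq (by ring)

lemma norm_convIter_sub_le {f g : Edim d → ℂ} {M ε : ℝ} (hS : volume S < ⊤)
    (hv : volume.real S ≤ v) (hfm : Measurable f) (hgm : Measurable g)
    (hf : ∀ η, ‖f η‖ ≤ M) (hg : ∀ η, ‖g η‖ ≤ M) (hfg : ∀ η, ‖f η - g η‖ ≤ ε)
    (hfS : ∀ η, η ∉ S → f η = 0) (hgS : ∀ η, η ∉ S → g η = 0) (n : ℕ) (ξ : Edim d) :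
    ‖convIter d f n ξ - convIter d g n ξ‖ ≤ (n + 1) * M ^ n * ε * v ^ n := by
  induction n generalizing ξ with
  | zero => simpa [convIter] using hfg ξ
  | succ n ih =>
    have hFm := measurable_convIter hfm n
    have hGm := measurable_convIter hgm n
    have hF := norm_convIter_le hS hv hf hfS n
    have hG := norm_convIter_le hS hv hg hgS n
    have hfgS : ∀ η, η ∉ S → (fun η => f η - g η) η = 0 := fun η hη => by
      simp [hfS η hη, hgS η hη]
    have key : convIter d f (n + 1) ξ - convIter d g (n + 1) ξ
        = conv d (fun ξ => convIter d f n ξ - convIter d g n ξ) f ξ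
          + conv d (convIter d g n) (fun η => f η - g η) ξ := by
      simp only [convIter, conv]
      rw [← integral_sub (integrable_conv hS hFm hfm hF hf hfS ξ)
        (integrable_conv hS hGm hgm hG hg hgS ξ),
        ← integral_add (integrable_conv hS (F := fun ξ => convIter d f n ξ - convIter d g n ξ)
          (hFm.sub hGm) hfm ih hf hfS ξ)
        (integrable_conv hS (f := fun η => f η - g η) hGm (hfm.sub hgm) hG hfg hfgS ξ)]
      congr 1
      ext η
      ring
    rw [key]
    refine (norm_add_le _ _).trans ((add_le_add (norm_conv_le hS hv ih hf hfS ξ)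
      (norm_conv_le hS hv hG hfg hfgS ξ)).trans_eq ?_)
    push_cast
    ring

lemma listConv_ofFn_const (f : Edim d → ℂ) (n : ℕ) :
    listConv d (List.ofFn fun _ : Fin (n + 1) => f) = convIter d f n := by
  rw [List.ofFn_const, List.replicate_succ, listConv]
  induction n with
  | zero => rfl
  | succ n ih => rw [List.replicate_succ', List.foldl_append, ih]; rfl

end Convolution

section Cubes

variable {d : ℕ}

lemma volume_box (l u : Fin d → ℝ) :
    volume {η : Edim d | ∀ i, l i ≤ η i ∧ η i ≤ u i} = ∏ i, ENNReal.ofReal (u i - l i) := by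
  rw [← Real.volume_Icc_pi, ← (PiLp.volume_preserving_ofLp (Fin d)).measure_preimage
    measurableSet_Icc.nullMeasurableSet]
  congr 1
  ext η
  simp [Pi.le_def, forall_and]

lemma measurableSet_cubeSet (A : ℝ) : MeasurableSet (cubeSet d A) := by
  have : cubeSet d A = ⋂ i, {ξ : Edim d | |ξ i| ≤ A / 8} := by ext; simp [cubeSet]
  rw [this]
  exact MeasurableSet.iInter fun i => measurableSet_le (by fun_prop) measurable_const

lemma volume_cubeSet {A : ℝ} (hA : 0 ≤ A) :
    volume (cubeSet d A) = ENNReal.ofReal ((A / 4) ^ d) := by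
  have : cubeSet d A = {η : Edim d | ∀ i, (fun _ => -(A / 8)) i ≤ η i ∧ η i ≤ (fun _ => A / 8) i} := by
    ext; simp [cubeSet, abs_le]
  rw [this, volume_box, Finset.prod_const, Finset.card_univ, Fintype.card_fin,
    ← ENNReal.ofReal_pow (by linarith)]
  congr 2
  ring

lemma volume_cubeSet_lt_top {A : ℝ} (hA : 0 ≤ A) : volume (cubeSet d A) < ⊤ := by
  rw [volume_cubeSet hA]; exact ENNReal.ofReal_lt_top

lemma volumeReal_cubeSet_le {A : ℝ} (hA : 0 ≤ A) : volume.real (cubeSet d A) ≤ A ^ d := by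
  rw [Measure.real, volume_cubeSet hA, ENNReal.toReal_ofReal (by positivity)]
  gcongr
  linarith

/-- The `(n+1)`-fold convolution power of `𝟙_{Q_A}`, as a real function. -/
def cubeConv (d : ℕ) (A : ℝ) : ℕ → Edim d → ℝ
  | 0 => (cubeSet d A).indicator 1
  | n + 1 => fun ξ => ∫ η in cubeSet d A, cubeConv d A n (ξ - η)

lemma cubeConv_nonneg (A : ℝ) (n : ℕ) (ξ : Edim d) : 0 ≤ cubeConv d A n ξ := by
  induction n generalizing ξ with
  | zero => exact indicator_nonneg (fun _ _ => zero_le_one) ξ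
  | succ n ih => exact integral_nonneg fun η => ih _

lemma measurable_cubeConv (A : ℝ) (n : ℕ) : Measurable (cubeConv d A n) := by
  induction n with
  | zero => exact measurable_one.indicator (measurableSet_cubeSet A)
  | succ n ih =>
    have h : Measurable (Function.uncurry fun ξ η : Edim d => cubeConv d A n (ξ - η)) :=
      ih.comp measurable_sub
    exact h.stronglyMeasurable.integral_prod_right.measurable

lemma cubeConv_le {A : ℝ} (hA : 0 ≤ A) (n : ℕ) (ξ : Edim d) :
    cubeConv d A n ξ ≤ (A ^ d) ^ n := by
  induction n generalizing ξ with
  | zero =>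
    simp only [cubeConv, pow_zero]
    exact indicator_le_self' (fun _ _ => zero_le_one) ξ |>.trans le_rfl
  | succ n ih =>
    have h := norm_setIntegral_le_of_norm_le_const (f := fun η => cubeConv d A n (ξ - η))
      (C := (A ^ d) ^ n) (volume_cubeSet_lt_top (d := d) hA) fun η _ => by
        rw [Real.norm_of_nonneg (cubeConv_nonneg _ _ _)]; exact ih _
    refine (le_abs_self _).trans (h.trans ?_)
    rw [pow_succ]
    gcongr
    exact volumeReal_cubeSet_le hA

lemma le_cubeConv {A : ℝ} (hA : 0 ≤ A) (n : ℕ) {ξ : Edim d} (hξ : ξ ∈ cubeSet d A) :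
    ((A / 8) ^ d) ^ n ≤ cubeConv d A n ξ := by
  induction n generalizing ξ with
  | zero => simp [cubeConv, hξ]
  | succ n ih =>
    let l : Fin d → ℝ := fun i => if 0 ≤ ξ i then 0 else -(A / 8)
    let T : Set (Edim d) := {η | ∀ i, l i ≤ η i ∧ η i ≤ l i + A / 8}
    have hT : ∀ η ∈ T, η ∈ cubeSet d A ∧ ξ - η ∈ cubeSet d A := by
      intro η hη
      refine ⟨fun i => ?_, fun i => ?_⟩ <;>
      · have h1 := hη i
        have h2 := abs_le.1 (hξ i)
        simp only [PiLp.sub_apply]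
        rw [abs_le]
        simp only [l] at h1
        split_ifs at h1 <;> constructor <;> linarith
    have hTm : MeasurableSet T := by
      have : T = ⋂ i, (fun η : Edim d => η i) ⁻¹' Icc (l i) (l i + A / 8) := by ext; simp [T]
      rw [this]
      have hm (i : Fin d) : Measurable fun η : Edim d => η i := by fun_prop
      exact MeasurableSet.iInter fun i => measurableSet_Icc.preimage (hm i)
    have hTv : volume T = ENNReal.ofReal ((A / 8) ^ d) := by
      rw [volume_box l fun i => l i + A / 8]
      simp [ENNReal.ofReal_pow (show 0 ≤ A / 8 by linarith)]
    have hint : IntegrableOn (fun η => cubeConv d A n (ξ - η)) (cubeSet d A) :=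
      Measure.integrableOn_of_bounded (M := (A ^ d) ^ n) (volume_cubeSet_lt_top hA).ne
        ((measurable_cubeConv A n).comp (measurable_const.sub measurable_id)).aestronglyMeasurable
        (ae_of_all _ fun η => by
          rw [Real.norm_of_nonneg (cubeConv_nonneg _ _ _)]; exact cubeConv_le hA _ _)
    have hsub : T ⊆ cubeSet d A := fun η hη => (hT η hη).1
    calc ((A / 8) ^ d) ^ (n + 1) = ∫ _ in T, ((A / 8) ^ d) ^ n := by
          rw [setIntegral_const, Measure.real, hTv, ENNReal.toReal_ofReal (by positivity),
            smul_eq_mul, pow_succ']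
      _ ≤ ∫ η in T, cubeConv d A n (ξ - η) :=
          setIntegral_mono_on (integrableOn_const (by rw [hTv]; exact ENNReal.ofReal_ne_top))
            (hint.mono_set hsub) hTm fun η hη => ih (hT η hη).2
      _ ≤ cubeConv d A (n + 1) ξ :=
          setIntegral_mono_set hint (ae_of_all _ fun η => cubeConv_nonneg _ _ _)
            hsub.eventuallyLE

/-- A superposition of indicators of the cubes `c N e + Q_A`, `c ∈ S`, with weights `a c`. -/
def cubeSum (S : Finset ℤ) (a : ℤ → ℝ) (A N : ℝ) (e : Edim d) (η : Edim d) : ℂ :=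
  ∑ c ∈ S, (a c : ℂ) * (cubeSet d A).indicator 1 (η - ((c : ℝ) * N) • e)

lemma measurable_cube_indicator (A : ℝ) :
    Measurable ((cubeSet d A).indicator (1 : Edim d → ℂ)) :=
  measurable_one.indicator (measurableSet_cubeSet A)

lemma measurable_cubeSum (S : Finset ℤ) (a : ℤ → ℝ) (A N : ℝ) (e : Edim d) :
    Measurable (cubeSum S a A N e) :=
  Finset.measurable_fun_sum _ fun _ _ => measurable_const.mul
    ((measurable_cube_indicator A).comp (measurable_id.sub measurable_const))

lemma notMem_cubeSet_add {A N : ℝ} {i₀ : Fin d} {ζ : Edim d} (hN : 0 ≤ N)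
    (hζ : |ζ i₀| + A / 8 < N) {m : ℤ} (hm : m ≠ 0) :
    ((m : ℝ) * N) • EuclideanSpace.single i₀ (1 : ℝ) + ζ ∉ cubeSet d A := by
  intro h
  have h1 := h i₀
  simp only [PiLp.add_apply, PiLp.smul_apply, PiLp.single_apply, if_true,
    smul_eq_mul, mul_one] at h1
  have h2 : (1 : ℝ) ≤ |(m : ℝ)| := by exact_mod_cast Int.one_le_abs hm
  have h3 : N ≤ |(m : ℝ) * N| := by rw [abs_mul, abs_of_nonneg hN]; nlinarith
  have h4 := abs_sub_abs_le_abs_sub ((m : ℝ) * N) (-ζ i₀)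
  rw [abs_neg, sub_neg_eq_add] at h4
  linarith

lemma cubeSum_apply {S : Finset ℤ} {a : ℤ → ℝ} {A N : ℝ} {i₀ : Fin d} {ζ : Edim d} (hN : 0 ≤ N)
    (hζ : |ζ i₀| + A / 8 < N) (m : ℤ) :
    cubeSum S a A N (EuclideanSpace.single i₀ 1)
      (((m : ℝ) * N) • EuclideanSpace.single i₀ 1 + ζ)
      = (if m ∈ S then a m else 0 : ℝ) * ((cubeSet d A).indicator 1 ζ : ℂ) := by
  have hsub (c : ℤ) : ((m : ℝ) * N) • EuclideanSpace.single i₀ (1 : ℝ) + ζ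
      - ((c : ℝ) * N) • EuclideanSpace.single i₀ 1
      = (((m - c : ℤ) : ℝ) * N) • EuclideanSpace.single i₀ 1 + ζ := by
    push_cast
    module
  have hne (c : ℤ) (hc : c ≠ m) : (cubeSet d A).indicator (1 : Edim d → ℂ)
      (((m : ℝ) * N) • EuclideanSpace.single i₀ (1 : ℝ) + ζ
        - ((c : ℝ) * N) • EuclideanSpace.single i₀ 1) = 0 := by
    rw [hsub]
    exact indicator_of_notMem (notMem_cubeSet_add hN hζ (sub_ne_zero.2 hc.symm)) _
  have heq : (cubeSet d A).indicator (1 : Edim d → ℂ)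
      (((m : ℝ) * N) • EuclideanSpace.single i₀ (1 : ℝ) + ζ
        - ((m : ℝ) * N) • EuclideanSpace.single i₀ 1) = (cubeSet d A).indicator 1 ζ := by
    rw [add_sub_cancel_left]
  unfold cubeSum
  split_ifs with h
  · rw [Finset.sum_eq_single_of_mem m h fun c _ hc => by rw [hne c hc, mul_zero], heq]
  · rw [Finset.sum_eq_zero]
    · simp
    · intro c hc
      rw [hne c (fun h' => h (h' ▸ hc)), mul_zero]

lemma convIter_cubeSum {S : Finset ℤ} {a : ℤ → ℝ} {A N : ℝ} {i₀ : Fin d} (hA : 0 ≤ A)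
    (hN : 0 ≤ N)
    (hbdd : ∀ n, ∃ M : ℝ, ∀ ξ,
      ‖convIter d (cubeSum S a A N (EuclideanSpace.single i₀ 1)) n ξ‖ ≤ M)
    (n : ℕ) {ζ : Edim d} (hζ : |ζ i₀| + (n + 1) * (A / 8) < N) (m : ℤ) :
    convIter d (cubeSum S a A N (EuclideanSpace.single i₀ 1)) n
      (((m : ℝ) * N) • EuclideanSpace.single i₀ 1 + ζ)
      = (convWeight S a n m : ℂ) * (cubeConv d A n ζ : ℂ) := by
  induction n generalizing ζ m with
  | zero =>
    have h := cubeSum_apply (S := S) (a := a) (ζ := ζ) (i₀ := i₀) hN (by simpa using hζ) m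
    simp only [convIter, convWeight, cubeConv, h]
    congr 1
    by_cases hm : ζ ∈ cubeSet d A <;> simp [hm]
  | succ n ih =>
    set e : Edim d := EuclideanSpace.single i₀ 1 with he
    set G := convIter d (cubeSum S a A N e) n with hG
    obtain ⟨M, hM⟩ := hbdd n
    have hGm : Measurable G := measurable_convIter (measurable_cubeSum S a A N e) n
    set ξ := ((m : ℝ) * N) • e + ζ with hξ
    have h1 : convIter d (cubeSum S a A N e) (n + 1) ξ = ∫ η, ∑ c ∈ S,
        (a c : ℂ) * (G (ξ - η) * (cubeSet d A).indicator 1 (η - ((c : ℝ) * N) • e)) := by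
      simp only [convIter, conv, ← hG]
      congr 1
      ext η
      rw [cubeSum, Finset.mul_sum]
      exact Finset.sum_congr rfl fun c _ => by ring
    have hshift (c : ℤ) :
        ∫ η, G (ξ - η) * (cubeSet d A).indicator 1 (η - ((c : ℝ) * N) • e)
        = (convWeight S a n (m - c) : ℂ) * (cubeConv d A (n + 1) ζ : ℂ) := by
      rw [← integral_add_right_eq_self _ (((c : ℝ) * N) • e)]
      simp only [add_sub_cancel_right]
      rw [← setIntegral_eq_integral_of_forall_compl_eq_zero (s := cubeSet d A)
        fun η hη => by rw [indicator_of_notMem hη, mul_zero]]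
      simp only [cubeConv]
      rw [← integral_complex_ofReal, ← integral_const_mul]
      refine setIntegral_congr_fun (measurableSet_cubeSet A) fun η hη => ?_
      have h2 : ξ - (η + ((c : ℝ) * N) • e) = (((m - c : ℤ) : ℝ) * N) • e + (ζ - η) := by
        rw [hξ]; push_cast; module
      have h3 : |(ζ - η) i₀| + (n + 1) * (A / 8) < N := by
        have := hη i₀
        have := abs_sub (ζ i₀) (η i₀)
        rw [PiLp.sub_apply]
        push_cast at hζ
        linarith
      beta_reduce
      rw [h2, ih h3, indicator_of_mem hη, Pi.one_apply, mul_one]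
    have hint (c : ℤ) : Integrable fun η =>
        G (ξ - η) * (cubeSet d A).indicator 1 (η - ((c : ℝ) * N) • e) := by
      have h := integrable_conv (volume_cubeSet_lt_top hA) hGm
        (measurable_cube_indicator A) hM (L := 1) (fun η => ?_)
        (fun η hη => indicator_of_notMem hη _) (ξ - ((c : ℝ) * N) • e)
      · refine (h.comp_sub_right (((c : ℝ) * N) • e)).congr (ae_of_all _ fun η => ?_)
        beta_reduce
        congr 2
        abel
      · by_cases hm : η ∈ cubeSet d A <;> simp [hm]
    rw [h1, integral_finsetSum _ fun c _ => (hint c).const_mul _]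
    simp only [integral_const_mul, hshift, convWeight]
    push_cast
    rw [Finset.sum_mul]
    exact Finset.sum_congr rfl fun c _ => by ring

end Cubes

section Data

variable {d k : ℕ}

lemma mem_OmegaKSet_iff (hd : 0 < d) (N A : ℝ) (ξ : Edim d) :
    ξ ∈ OmegaKSet d k N A ↔ ∃ c ∈ centers k,
      ξ - ((c : ℝ) * N) • EuclideanSpace.single ⟨0, hd⟩ (1 : ℝ) ∈ cubeSet d A := by
  have h (x : ℝ) : (∀ i : Fin d, |ξ i - (if (i : ℕ) = 0 then x else 0)| ≤ A / 8) ↔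
      ξ - x • EuclideanSpace.single ⟨0, hd⟩ (1 : ℝ) ∈ cubeSet d A := by
    simp [cubeSet, PiLp.single_apply, Fin.ext_iff]
  by_cases hk : k % 2 = 0
  · simp [OmegaKSet, centers, hk, h]
  · simp [OmegaKSet, centers, hk, h]

lemma OmegaKSet_eq_iUnion (hd : 0 < d) (N A : ℝ) :
    OmegaKSet d k N A = ⋃ c ∈ centers k, (fun ξ : Edim d =>
      ξ - ((c : ℝ) * N) • EuclideanSpace.single ⟨0, hd⟩ (1 : ℝ)) ⁻¹' cubeSet d A := by
  ext ξ
  simp [mem_OmegaKSet_iff hd]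

lemma measurableSet_OmegaKSet (hd : 0 < d) (N A : ℝ) : MeasurableSet (OmegaKSet d k N A) := by
  rw [OmegaKSet_eq_iUnion hd]
  exact Finset.measurableSet_biUnion _ fun _ _ =>
    (measurable_id.sub measurable_const) (measurableSet_cubeSet A)

lemma volume_OmegaKSet_lt_top (hd : 0 < d) (N : ℝ) {A : ℝ} (hA : 0 ≤ A) :
    volume (OmegaKSet d k N A) < ⊤ := by
  rw [OmegaKSet_eq_iUnion hd]
  refine (measure_biUnion_finset_le _ _).trans_lt (ENNReal.sum_lt_top.2 fun c _ => ?_)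
  simp_rw [sub_eq_add_neg, measure_preimage_add_right]
  exact volume_cubeSet_lt_top hA

lemma volumeReal_OmegaKSet_le (hd : 0 < d) (N : ℝ) {A : ℝ} (hA : 0 ≤ A) :
    volume.real (OmegaKSet d k N A) ≤ 4 * A ^ d := by
  rw [OmegaKSet_eq_iUnion hd]
  refine (measureReal_biUnion_finset_le _ _).trans ?_
  have h (c : ℤ) : volume.real ((fun ξ : Edim d =>
      ξ - ((c : ℝ) * N) • EuclideanSpace.single ⟨0, hd⟩ (1 : ℝ)) ⁻¹' cubeSet d A) ≤ A ^ d := by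
    simp_rw [Measure.real, sub_eq_add_neg, measure_preimage_add_right]
    exact volumeReal_cubeSet_le hA
  refine (Finset.sum_le_card_nsmul _ _ _ fun c _ => h c).trans ?_
  rw [nsmul_eq_mul]
  gcongr
  exact_mod_cast card_centers_le k

lemma norm_le_of_mem_cubeSet {A : ℝ} (hA : 0 ≤ A) {ζ : Edim d} (hζ : ζ ∈ cubeSet d A) :
    ‖ζ‖ ≤ d * (A / 8) := by
  rw [EuclideanSpace.norm_eq]
  refine Real.sqrt_le_iff.2 ⟨by positivity, ?_⟩
  have h : ∀ i ∈ Finset.univ, ‖ζ i‖ ^ 2 ≤ (A / 8) ^ 2 := fun i _ =>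
    pow_le_pow_left₀ (norm_nonneg _) (hζ i) 2
  refine (Finset.sum_le_card_nsmul _ _ _ h).trans ?_
  rw [Finset.card_univ, Fintype.card_fin, nsmul_eq_mul, mul_pow]
  gcongr
  exact_mod_cast Nat.le_self_pow two_ne_zero d

lemma Vflow_phiHatK_of_mem {N A R t : ℝ} {η : Edim d} (hη : η ∈ OmegaKSet d k N A) :
    Vflow d (phiHatK d k N A R) (fun _ => 0) t η = ((R * prof (‖η‖ * t) : ℝ) : ℂ) := by
  rw [Vflow, Psym_mul_V0sym, phiHatK, indicator_of_mem hη]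
  push_cast
  ring

lemma Vflow_phiHatK_of_notMem {N A R t : ℝ} {η : Edim d} (hη : η ∉ OmegaKSet d k N A) :
    Vflow d (phiHatK d k N A R) (fun _ => 0) t η = 0 := by
  rw [Vflow, phiHatK, indicator_of_notMem hη]
  ring

lemma measurable_Vflow_phiHatK (hd : 0 < d) (N A R : ℝ) :
    Measurable (Function.uncurry (Vflow d (phiHatK d k N A R) fun _ => 0)) := by
  have h : Function.uncurry (Vflow d (phiHatK d k N A R) fun _ => 0)
      = fun p => ((prof (‖p.2‖ * p.1) : ℝ) : ℂ) * phiHatK d k N A R p.2 := by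
    ext p
    simp only [Function.uncurry, Vflow, Psym_mul_V0sym, mul_zero, add_zero]
  rw [h]
  have h1 : Measurable (phiHatK d k N A R) :=
    measurable_const.indicator (measurableSet_OmegaKSet hd N A)
  have h2 : Measurable fun p : ℝ × Edim d => prof (‖p.2‖ * p.1) :=
    continuous_prof.measurable.comp (by fun_prop)
  exact (Complex.measurable_ofReal.comp h2).mul (h1.comp measurable_snd)

lemma mul_exp_neg_le {N : ℝ} (hN : 0 < N) (t : ℝ) : t * exp (-(N * t)) ≤ 1 / N := by
  have h : N * t * exp (-(N * t)) ≤ 1 := by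
    have h1 := add_one_le_exp (N * t)
    have h2 : exp (N * t) * exp (-(N * t)) = 1 := by rw [← exp_add]; simp
    nlinarith [exp_pos (-(N * t))]
  rw [le_div_iff₀ hN]
  linarith

/-- Frozen-frequency approximation of the linear evolution of `φ̂`. -/
def frozenFlow (d k : ℕ) (hd : 0 < d) (N A R t : ℝ) : Edim d → ℂ :=
  cubeSum (centers k) (fun c => R * prof (|(c : ℝ)| * (N * t))) A N
    (EuclideanSpace.single ⟨0, hd⟩ 1)

lemma frozenFlow_of_notMem {hd : 0 < d} {N A R t : ℝ} {η : Edim d}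
    (hη : η ∉ OmegaKSet d k N A) : frozenFlow d k hd N A R t η = 0 := by
  refine Finset.sum_eq_zero fun c hc => ?_
  rw [indicator_of_notMem, mul_zero]
  exact fun h => hη ((mem_OmegaKSet_iff hd N A η).2 ⟨c, hc, h⟩)

lemma exists_frozenFlow_eq {hd : 0 < d} {N A : ℝ} (hA : 0 < A) (hAN : d * A ≤ N)
    {η : Edim d} (hη : η ∈ OmegaKSet d k N A) :
    ∃ c : ℤ, N ≤ |(c : ℝ)| * N ∧ |‖η‖ - |(c : ℝ)| * N| ≤ d * (A / 8) ∧
      ∀ R t, frozenFlow d k hd N A R t η = ((R * prof (|(c : ℝ)| * N * t) : ℝ) : ℂ) := by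
  obtain ⟨c, hc, hζ⟩ := (mem_OmegaKSet_iff hd N A η).1 hη
  set ζ := η - ((c : ℝ) * N) • EuclideanSpace.single ⟨0, hd⟩ (1 : ℝ) with hζdef
  have hd1 : (1 : ℝ) ≤ d := by exact_mod_cast hd
  have hAN' : A ≤ N := by nlinarith
  have hN : 0 < N := hA.trans_le hAN'
  have hηeq : η = ((c : ℝ) * N) • EuclideanSpace.single ⟨0, hd⟩ (1 : ℝ) + ζ := by
    rw [hζdef, add_sub_cancel]
  refine ⟨c, by nlinarith [one_le_abs_of_mem_centers hc], ?_, fun R t => ?_⟩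
  · have h1 : ‖((c : ℝ) * N) • EuclideanSpace.single (⟨0, hd⟩ : Fin d) (1 : ℝ)‖
        = |(c : ℝ)| * N := by
      rw [norm_smul, PiLp.norm_single, norm_one, mul_one, norm_mul,
        Real.norm_of_nonneg hN.le, Real.norm_eq_abs]
    rw [← h1]
    exact (abs_norm_sub_norm_le _ _).trans (norm_le_of_mem_cubeSet hA.le hζ)
  · rw [frozenFlow, hηeq, cubeSum_apply hN.le (by have := hζ ⟨0, hd⟩; linarith), if_pos hc,
      indicator_of_mem hζ, Pi.one_apply, mul_one, mul_assoc]

lemma norm_frozenFlow_le {hd : 0 < d} {N A R t : ℝ} (hA : 0 < A) (hAN : d * A ≤ N)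
    (hR : 0 ≤ R) (ht : 0 ≤ t) (η : Edim d) : ‖frozenFlow d k hd N A R t η‖ ≤ 2 * R := by
  by_cases hη : η ∈ OmegaKSet d k N A
  · obtain ⟨c, hc, -, h⟩ := exists_frozenFlow_eq (hd := hd) hA hAN hη
    have hN : 0 ≤ N := (by positivity : 0 ≤ d * A).trans hAN
    rw [h, Complex.norm_real, norm_mul, Real.norm_of_nonneg hR, mul_comm]
    gcongr
    refine (abs_prof_le _).trans ?_
    have : exp (-(|(c : ℝ)| * N * t) / 2) ≤ 1 :=
      exp_le_one_iff.2 (by have : 0 ≤ |(c : ℝ)| * N * t := by positivity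
                           linarith)
    linarith
  · rw [frozenFlow_of_notMem hη, norm_zero]
    positivity

lemma norm_Vflow_phiHatK_le {N A R t : ℝ} (hR : 0 ≤ R) (ht : 0 ≤ t) (η : Edim d) :
    ‖Vflow d (phiHatK d k N A R) (fun _ => 0) t η‖ ≤ 2 * R := by
  by_cases hη : η ∈ OmegaKSet d k N A
  · rw [Vflow_phiHatK_of_mem hη, Complex.norm_real, norm_mul, Real.norm_of_nonneg hR, mul_comm]
    gcongr
    refine (abs_prof_le _).trans ?_
    have : exp (-(‖η‖ * t) / 2) ≤ 1 :=
      exp_le_one_iff.2 (by have : 0 ≤ ‖η‖ * t := by positivity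
                           linarith)
    linarith
  · rw [Vflow_phiHatK_of_notMem hη, norm_zero]
    positivity

lemma norm_Vflow_sub_frozenFlow_le {hd : 0 < d} {N A R t : ℝ} (hA : 0 < A) (hAN : d * A ≤ N)
    (hR : 0 ≤ R) (ht : 0 ≤ t) (η : Edim d) :
    ‖Vflow d (phiHatK d k N A R) (fun _ => 0) t η - frozenFlow d k hd N A R t η‖
      ≤ 2 * d * R * (A / N) * exp (-(N * t) / 8) := by
  have hd1 : (1 : ℝ) ≤ d := by exact_mod_cast hd
  have hN : 0 < N := (by positivity : 0 < d * A).trans_le hAN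
  by_cases hη : η ∈ OmegaKSet d k N A
  · obtain ⟨c, hc, hcη, h⟩ := exists_frozenFlow_eq (hd := hd) hA hAN hη
    have hηN : N / 2 ≤ ‖η‖ := by
      have := (abs_le.1 hcη).1
      linarith
    rw [Vflow_phiHatK_of_mem hη, h, ← Complex.ofReal_sub, Complex.norm_real, ← mul_sub, norm_mul,
      Real.norm_of_nonneg hR, Real.norm_eq_abs]
    have h1 := abs_prof_sub_le (ρ := N / 2 * t) (x := ‖η‖ * t) (y := |(c : ℝ)| * N * t)
      (by gcongr) (by gcongr; linarith)
    rw [← sub_mul, abs_mul, abs_of_nonneg ht] at h1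
    have h2 : t * exp (-(N / 2 * t) / 2) ≤ 8 / N * exp (-(N * t) / 8) := by
      have h3 := mul_exp_neg_le (N := N / 8) (by positivity) t
      rw [show -(N / 2 * t) / 2 = -(N / 8 * t) + -(N * t) / 8 by ring, exp_add, ← mul_assoc]
      gcongr
      exact h3.trans_eq (by field_simp)
    calc R * |prof (‖η‖ * t) - prof (|(c : ℝ)| * N * t)|
        ≤ R * (2 * exp (-(N / 2 * t) / 2) * (d * (A / 8) * t)) := by
          refine mul_le_mul_of_nonneg_left (h1.trans ?_) hR
          gcongr
      _ = R * (2 * (d * (A / 8))) * (t * exp (-(N / 2 * t) / 2)) := by ring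
      _ ≤ R * (2 * (d * (A / 8))) * (8 / N * exp (-(N * t) / 8)) := by gcongr
      _ = _ := by ring
  · rw [Vflow_phiHatK_of_notMem hη, frozenFlow_of_notMem hη, sub_zero, norm_zero]
    positivity

lemma norm_convIter_Vflow_sub_le {hd : 0 < d} {N A R t : ℝ} (hA : 0 < A) (hAN : d * A ≤ N)
    (hR : 0 ≤ R) (ht : 0 ≤ t) (n : ℕ) {ζ : Edim d}
    (hζ : |ζ ⟨0, hd⟩| + (n + 1) * (A / 8) < N) :
    ‖convIter d (Vflow d (phiHatK d (n + 1) N A R) (fun _ => 0) t) n ζ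
        - ((R ^ (n + 1) * cubeConv d A n ζ : ℝ) : ℂ) * ((resonance (n + 1) (N * t) : ℝ) : ℂ)‖
      ≤ (n + 1) * (2 * R) ^ n * (2 * d * R * (A / N) * exp (-(N * t) / 8)) * (4 * A ^ d) ^ n := by
  have hN : 0 ≤ N := (by positivity : 0 ≤ d * A).trans hAN
  have hS := volume_OmegaKSet_lt_top (k := n + 1) hd N hA.le
  have hv := volumeReal_OmegaKSet_le (k := n + 1) hd N hA.le
  have hg := norm_frozenFlow_le (k := n + 1) (hd := hd) hA hAN hR ht
  have hgS : ∀ η, η ∉ OmegaKSet d (n + 1) N A → frozenFlow d (n + 1) hd N A R t η = 0 :=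
    fun η hη => frozenFlow_of_notMem hη
  have h := norm_convIter_sub_le hS hv (measurable_Vflow_phiHatK hd N A R).of_uncurry_left
    (measurable_cubeSum _ _ A N _) (norm_Vflow_phiHatK_le hR ht) hg
    (norm_Vflow_sub_frozenFlow_le hA hAN hR ht) (fun η hη => Vflow_phiHatK_of_notMem hη)
    hgS n ζ
  have h2 := convIter_cubeSum (S := centers (n + 1))
    (a := fun c => R * prof (|(c : ℝ)| * (N * t))) hA.le hN
    (fun m => ⟨_, norm_convIter_le hS hv hg hgS m⟩) n hζ 0
  rw [convWeight_const_mul, Int.cast_zero, zero_mul, zero_smul, zero_add] at h2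
  refine le_of_eq_of_le ?_ h
  rw [h2, resonance, Nat.add_sub_cancel]
  congr 2
  push_cast
  ring

end Data

section Duhamel

lemma Xi_one_apply (d n : ℕ) (F₀ F₁ : Edim d → ℂ) (t : ℝ) (ξ : Edim d) :
    Xi d (n + 1) F₀ F₁ 1 t ξ = -(∫ t' in (0 : ℝ)..t, ((Wsym (t - t') ‖ξ‖ : ℝ) : ℂ) *
      convIter d (Vflow d F₀ F₁ t') n ξ) := by
  rw [Xi]
  beta_reduce
  rw [Finset.sum_attach (Finset.Nat.antidiagonalTuple (n + 1) 0)
    fun l => Ik d (n + 1) (fun i => Xi d (n + 1) F₀ F₁ (l i)) t ξ,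
    Finset.Nat.antidiagonalTuple_zero_right, Finset.sum_singleton, Ik]
  simp only [Pi.zero_apply, Xi, listConv_ofFn_const]

lemma abs_Wsym_le {s r : ℝ} (hs : 0 ≤ s) (hr : 0 < r) : |Wsym s r| ≤ s := by
  have hP : Psym s r ≤ 1 := exp_le_one_iff.2 (by have := mul_nonneg hr.le hs; linarith)
  have hP0 : 0 ≤ Psym s r := (exp_pos _).le
  have hV : |V1sym s r| ≤ s := by
    have hr' : 0 < √3 / 2 * r := by positivity
    rw [V1sym, abs_div, abs_of_pos hr', div_le_iff₀ hr']
    refine abs_sin_le_abs.trans_eq ?_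
    rw [abs_of_nonneg (by positivity)]
    ring
  rw [Wsym, abs_mul, abs_of_nonneg hP0]
  exact (mul_le_of_le_one_left (abs_nonneg _) hP).trans hV

lemma abs_sin_sub_self_le {y : ℝ} (hy : 0 ≤ y) : |sin y - y| ≤ 2 * y ^ 2 := by
  rw [abs_sub_comm, abs_of_nonneg (sub_nonneg.2 (sin_le hy))]
  rcases le_total y 1 with h | h
  · rcases hy.eq_or_lt with rfl | hy
    · simp
    · nlinarith [sin_gt_sub_cube hy, mul_nonneg (sq_nonneg y) (sub_nonneg.2 h)]
  · nlinarith [neg_one_le_sin y]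

lemma abs_Wsym_sub_le {s r : ℝ} (hs : 0 ≤ s) (hr : 0 < r) : |Wsym s r - s| ≤ 3 * r * s ^ 2 := by
  have hP : Psym s r ≤ 1 := exp_le_one_iff.2 (by have := mul_nonneg hr.le hs; linarith)
  have hP0 : 0 ≤ Psym s r := (exp_pos _).le
  have hP1 : 1 - Psym s r ≤ r * s / 2 := by
    have := add_one_le_exp (-(r * s) / 2)
    rw [Psym]
    linarith
  have hr' : 0 < √3 / 2 * r := by positivity
  have hV : |V1sym s r - s| ≤ 2 * r * s ^ 2 := by
    have h := abs_sin_sub_self_le (y := √3 / 2 * r * s) (by positivity)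
    have h1 : V1sym s r - s = (sin (√3 / 2 * r * s) - √3 / 2 * r * s) / (√3 / 2 * r) := by
      rw [V1sym]; field_simp
    rw [h1, abs_div, abs_of_pos hr', div_le_iff₀ hr']
    refine h.trans ?_
    have h3 := sqrt_three_le_two
    have h4 : √3 / 2 * (√3 / 2 * r * (r * s ^ 2)) ≤ 1 * (√3 / 2 * r * (r * s ^ 2)) := by
      gcongr; linarith
    nlinarith
  have h2 : Wsym s r - s = Psym s r * (V1sym s r - s) + -((1 - Psym s r) * s) := by
    rw [Wsym]; ring
  rw [h2]
  refine (abs_add_le _ _).trans ?_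
  rw [abs_neg, abs_mul, abs_of_nonneg hP0, abs_of_nonneg (mul_nonneg (by linarith) hs)]
  have h3 := mul_le_of_le_one_left (abs_nonneg (V1sym s r - s)) hP
  have h4 : (1 - Psym s r) * s ≤ r * s / 2 * s := by gcongr
  have h5 : 0 ≤ r * s ^ 2 := by positivity
  nlinarith

lemma integral_exp_neg_le {N : ℝ} (hN : 0 < N) (t : ℝ) :
    ∫ x in (0 : ℝ)..t, exp (-(N * x)) ≤ 1 / N := by
  have h (x : ℝ) : HasDerivAt (fun x => -(1 / N) * exp (-(N * x))) (exp (-(N * x))) x := by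
    have h1 : HasDerivAt (fun x => -(N * x)) (-N) x := by
      simpa using ((hasDerivAt_id x).const_mul N).fun_neg
    refine (h1.exp.const_mul (-(1 / N))).congr_deriv ?_
    field_simp
  rw [intervalIntegral.integral_eq_sub_of_hasDerivAt (fun x _ => h x)
    (Continuous.intervalIntegrable (by fun_prop) _ _)]
  have : 0 ≤ 1 / N * exp (-(N * t)) := by positivity
  simp only [mul_zero, neg_zero, exp_zero]
  linarith

lemma norm_integral_Wsym_mul_sub_le {N t r E C Z : ℝ} (hN : 0 < N) (ht : 0 ≤ t) (hr : 0 < r)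
    (hZ : 0 ≤ Z) {G : ℝ → ℂ} (hG : Measurable G) {p : ℝ → ℝ} (hp : Continuous p)
    (hpC : ∀ τ, 0 ≤ τ → |p τ| ≤ C * exp (-τ / 2))
    (hGp : ∀ t', 0 ≤ t' → ‖G t' - (Z : ℂ) * (p (N * t') : ℂ)‖ ≤ E * exp (-(N * t') / 8)) :
    ‖(∫ t' in (0 : ℝ)..t, ((Wsym (t - t') r : ℝ) : ℂ) * G t')
        - ((t * Z * ∫ t' in (0 : ℝ)..t, p (N * t') : ℝ) : ℂ)‖
      ≤ (t * E + (3 * r * t ^ 2 + 16 / N) * (Z * C)) * (16 / N) := by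
  have hC : 0 ≤ C := by simpa using (abs_nonneg _).trans (hpC 0 le_rfl)
  have hE : 0 ≤ E := by simpa using (norm_nonneg _).trans (hGp 0 le_rfl)
  have hpC' (t' : ℝ) (ht' : 0 ≤ t') : |p (N * t')| ≤ C * exp (-(N * t') / 8) := by
    have : 0 ≤ N * t' := by positivity
    exact (hpC _ this).trans (mul_le_mul_of_nonneg_left (exp_le_exp.2 (by linarith)) hC)
  have hexp (t' : ℝ) (ht' : 0 ≤ t') : exp (-(N * t') / 8) ≤ 1 :=
    exp_le_one_iff.2 (by have : 0 ≤ N * t' := by positivity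
                         linarith)
  have hW : Continuous fun t' => Wsym (t - t') r := by
    unfold Wsym Psym V1sym
    fun_prop
  have hint1 : IntervalIntegrable (fun t' => ((Wsym (t - t') r : ℝ) : ℂ) * G t') volume 0 t := by
    rw [intervalIntegrable_iff_integrableOn_Ioc_of_le ht]
    refine Measure.integrableOn_of_bounded (M := t * (E + Z * C)) measure_Ioc_lt_top.ne
      ((Complex.measurable_ofReal.comp hW.measurable).mul hG).aestronglyMeasurable ?_
    refine (ae_restrict_iff' measurableSet_Ioc).2 (ae_of_all _ fun t' ht' => ?_)
    have h1 := abs_Wsym_le (s := t - t') (by linarith [ht'.2]) hr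
    have h2 : ‖G t'‖ ≤ E + Z * C := by
      have h3 := norm_sub_norm_le (G t') ((Z : ℂ) * (p (N * t') : ℂ))
      have h4 := hGp t' ht'.1.le
      have h5 := hpC' t' ht'.1.le
      rw [norm_mul, Complex.norm_real, Complex.norm_real, Real.norm_of_nonneg hZ,
        Real.norm_eq_abs] at h3
      have h6 := mul_le_of_le_one_right hE (hexp t' ht'.1.le)
      have h7 := mul_le_of_le_one_right hC (hexp t' ht'.1.le)
      have h8 : Z * |p (N * t')| ≤ Z * C := by gcongr; linarith
      linarith
    rw [norm_mul, Complex.norm_real, Real.norm_eq_abs]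
    exact mul_le_mul (h1.trans (by linarith [ht'.1])) h2 (norm_nonneg _) ht
  have hp' : Continuous fun t' => t * Z * p (N * t') := by fun_prop
  have hint2 : IntervalIntegrable (fun t' => ((t * Z * p (N * t') : ℝ) : ℂ)) volume 0 t :=
    (Complex.continuous_ofReal.comp hp').intervalIntegrable _ _
  rw [← intervalIntegral.integral_const_mul, ← intervalIntegral.integral_ofReal,
    ← intervalIntegral.integral_sub hint1 hint2]
  have hbd (t' : ℝ) (ht' : t' ∈ Ioc 0 t) :
      ‖((Wsym (t - t') r : ℝ) : ℂ) * G t' - ((t * Z * p (N * t') : ℝ) : ℂ)‖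
        ≤ (t * E + (3 * r * t ^ 2 + 16 / N) * (Z * C)) * exp (-(N / 16 * t')) := by
    have hs : 0 ≤ t - t' := by linarith [ht'.2]
    have hst : t - t' ≤ t := by linarith [ht'.1]
    have hsplit : ((Wsym (t - t') r : ℝ) : ℂ) * G t' - ((t * Z * p (N * t') : ℝ) : ℂ)
        = ((Wsym (t - t') r : ℝ) : ℂ) * (G t' - (Z : ℂ) * (p (N * t') : ℂ))
          + (((Wsym (t - t') r - t) * (Z * p (N * t')) : ℝ) : ℂ) := by
      push_cast; ring
    have h1 := (abs_Wsym_le hs hr).trans hst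
    have h2 : |Wsym (t - t') r - t| ≤ 3 * r * t ^ 2 + t' := by
      have h3 := abs_Wsym_sub_le hs hr
      have h4 : 3 * r * (t - t') ^ 2 ≤ 3 * r * t ^ 2 := by gcongr
      have h5 := abs_sub_le (Wsym (t - t') r) (t - t') t
      rw [show t - t' - t = -t' by ring, abs_neg, abs_of_pos ht'.1] at h5
      linarith
    have he : exp (-(N * t') / 8) = exp (-(N / 16 * t')) * exp (-(N / 16 * t')) := by
      rw [← exp_add]; congr 1; ring
    have he1 : exp (-(N / 16 * t')) ≤ 1 :=
      exp_le_one_iff.2 (by have : 0 ≤ N / 16 * t' := mul_nonneg (by positivity) ht'.1.le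
                           linarith)
    have he2 : t' * exp (-(N / 16 * t')) ≤ 16 / N :=
      (mul_exp_neg_le (N := N / 16) (by positivity) t').trans_eq (by field_simp)
    have he3 : exp (-(N * t') / 8) ≤ exp (-(N / 16 * t')) := by
      rw [he]; exact mul_le_of_le_one_left (exp_pos _).le he1
    rw [hsplit]
    refine (norm_add_le _ _).trans ?_
    rw [norm_mul, Complex.norm_real, Complex.norm_real, Real.norm_eq_abs, Real.norm_eq_abs,
      abs_mul, abs_mul, abs_of_nonneg hZ]
    have h3 := hGp t' ht'.1.le
    have h4 := hpC' t' ht'.1.le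
    have ht'0 := ht'.1.le
    calc |Wsym (t - t') r| * ‖G t' - (Z : ℂ) * (p (N * t') : ℂ)‖
          + |Wsym (t - t') r - t| * (Z * |p (N * t')|)
        ≤ t * (E * exp (-(N * t') / 8))
          + (3 * r * t ^ 2 + t') * (Z * (C * exp (-(N * t') / 8))) := by gcongr
      _ = (t * E + 3 * r * t ^ 2 * (Z * C)) * exp (-(N * t') / 8)
          + Z * C * (t' * exp (-(N / 16 * t'))) * exp (-(N / 16 * t')) := by rw [he]; ring
      _ ≤ (t * E + 3 * r * t ^ 2 * (Z * C)) * exp (-(N / 16 * t'))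
          + Z * C * (16 / N) * exp (-(N / 16 * t')) := by gcongr
      _ = _ := by ring
  refine (intervalIntegral.norm_integral_le_of_norm_le ht (ae_of_all _ hbd)
    (Continuous.intervalIntegrable (by fun_prop) _ _)).trans ?_
  rw [intervalIntegral.integral_const_mul]
  gcongr
  exact (integral_exp_neg_le (N := N / 16) (by positivity) t).trans_eq (by field_simp)

lemma exists_Xi_one_lower_bound {d k : ℕ} (hd : 1 ≤ d) (hk2 : 2 ≤ k) (hk5 : k ≤ 5) :
    ∃ c δ K : ℝ, 0 < c ∧ 0 < δ ∧ δ ≤ 1 ∧ 0 < K ∧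
      ∀ A N R t : ℝ, 1 ≤ A → A / δ ≤ N → 0 < R → K / N ≤ t →
        ∀ ξ : Edim d, ξ ≠ 0 → ‖ξ‖ ≤ δ * A → ‖ξ‖ * t ≤ δ →
          c * (R ^ k * (A ^ d) ^ (k - 1) * (t / N))
            ≤ ‖Xi d k (phiHatK d k N A R) (fun _ => 0) 1 t ξ‖ := by
  obtain ⟨I, hI, hlim⟩ := tendsto_integral_resonance hk2 hk5
  obtain ⟨n, rfl⟩ : ∃ n, k = n + 1 := ⟨k - 1, by omega⟩
  have hI' : 0 < |I| := abs_pos.2 hI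
  obtain ⟨K₀, hK₀⟩ := eventually_atTop.1
    (hlim.abs.eventually (lt_mem_nhds (half_lt_self hI')))
  have hd0 : 0 < d := hd
  have hdR : (1 : ℝ) ≤ d := by exact_mod_cast hd
  set b : ℝ := ((1 / 8) ^ d) ^ n with hb
  have hb0 : 0 < b := by positivity
  set C : ℝ := 8 ^ (n + 1) with hC
  set CE : ℝ := (n + 1) * 2 ^ n * (2 * d) * 4 ^ n with hCE
  have hC0 : 0 < C := by positivity
  have hCE0 : 0 < CE := by positivity
  set δ : ℝ := min (1 / (8 * (d + n))) (b * |I| / (128 * (CE + 3 * C))) with hδ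
  set K : ℝ := max K₀ (2048 * C / (b * |I|)) with hK
  have hδ0 : 0 < δ := by
    rw [hδ]; refine lt_min (by positivity) (by positivity)
  have hδ1 : δ * (8 * (d + n)) ≤ 1 := by
    have := min_le_left (1 / (8 * ((d : ℝ) + n))) (b * |I| / (128 * (CE + 3 * C)))
    rwa [← hδ, le_div_iff₀ (by positivity)] at this
  have hδ2 : 16 * (CE * δ + 3 * C * δ) ≤ b * |I| / 8 := by
    have := min_le_right (1 / (8 * ((d : ℝ) + n))) (b * |I| / (128 * (CE + 3 * C)))
    rw [← hδ, le_div_iff₀ (by positivity)] at this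
    linarith
  have hK0 : 0 < K := lt_max_of_lt_right (by positivity)
  have hK2 : 16 * (16 * C) ≤ b * |I| / 8 * K := by
    have := le_max_right K₀ (2048 * C / (b * |I|))
    rw [← hK, div_le_iff₀ (by positivity)] at this
    linarith
  have hnδ : 0 ≤ δ * n := by positivity
  have hdδ : δ ≤ δ * d := le_mul_of_one_le_right hδ0.le hdR
  refine ⟨b * |I| / 4, δ, K, by positivity, hδ0, by linarith, hK0, ?_⟩
  intro A N R t hA hAN hR hKt ξ hξ0 hξA hξt
  have hA0 : 0 < A := by linarith
  rw [div_le_iff₀ hδ0] at hAN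
  have hN : 0 < N := pos_of_mul_pos_left (hA0.trans_le hAN) hδ0.le
  have ht : 0 < t := (by positivity : 0 < K / N).trans_le hKt
  have hKNt : K ≤ N * t := by rwa [div_le_iff₀ hN, mul_comm] at hKt
  have hdA : d * A ≤ N := by nlinarith
  have hcoord (i : Fin d) : |ξ i| ≤ A / 8 := (PiLp.norm_apply_le ξ i).trans (by nlinarith)
  have hξ_i : |ξ ⟨0, hd0⟩| + (n + 1) * (A / 8) < N := by
    have h1 := hcoord ⟨0, hd0⟩
    have h2 : (n + 2) * (A / 8) ≤ (n + 2) * (N * δ / 8) := by gcongr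
    nlinarith
  set B := cubeConv d A n ξ with hB
  have hB1 : B ≤ (A ^ d) ^ n := cubeConv_le hA0.le n ξ
  have hB0 : 0 ≤ B := cubeConv_nonneg A n ξ
  have hB2 : b * (A ^ d) ^ n ≤ B := by
    refine le_of_eq_of_le ?_ (le_cubeConv hA0.le n (ξ := ξ) hcoord)
    rw [hb, ← mul_pow, ← mul_pow]
    congr 2
    ring
  set Y : ℝ := R ^ (n + 1) * (A ^ d) ^ n with hY
  have hY0 : 0 < Y := by positivity
  set Z : ℝ := R ^ (n + 1) * B with hZ
  have hZ0 : 0 ≤ Z := by positivity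
  have hZ1 : Z ≤ Y := by rw [hZ, hY]; gcongr
  have hZ2 : b * Y ≤ Z := by
    rw [hZ, hY, mul_left_comm]; gcongr
  have hr : 0 < ‖ξ‖ := norm_pos_iff.2 hξ0
  have hmeas : Measurable fun t' =>
      convIter d (Vflow d (phiHatK d (n + 1) N A R) (fun _ => 0) t') n ξ :=
    (measurable_convIter_uncurry (measurable_Vflow_phiHatK hd0 N A R) n).of_uncurry_right
  have herr := norm_integral_Wsym_mul_sub_le (E := CE * Y * (A / N)) hN ht.le hr hZ0 hmeas
    (continuous_resonance (n + 1)) (fun τ hτ => abs_resonance_le (by omega) hτ)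
    (fun t' ht' => (norm_convIter_Vflow_sub_le hA0 hdA hR.le ht' n hξ_i).trans_eq (by
      rw [hCE, hY, mul_pow, mul_pow, pow_succ]; ring))
  rw [← hC] at herr
  rw [Xi_one_apply, norm_neg, Nat.add_sub_cancel, ← hY]
  set J := ∫ t' in (0 : ℝ)..t, ((Wsym (t - t') ‖ξ‖ : ℝ) : ℂ) *
    convIter d (Vflow d (phiHatK d (n + 1) N A R) (fun _ => 0) t') n ξ
  rw [intervalIntegral.integral_comp_mul_left (fun τ => resonance (n + 1) τ) hN.ne', mul_zero]
    at herr
  have hres := hK₀ (N * t) ((le_max_left _ _).trans hKNt)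
  set I' := ∫ τ in (0 : ℝ)..N * t, resonance (n + 1) τ
  have hmain : b * |I| / 2 * (Y * (t / N)) ≤ ‖((t * Z * N⁻¹ • I' : ℝ) : ℂ)‖ := by
    rw [Complex.norm_real, Real.norm_eq_abs, smul_eq_mul, abs_mul (t * Z), abs_mul t Z,
      abs_mul N⁻¹, abs_of_pos ht, abs_of_nonneg hZ0, abs_of_pos (inv_pos.2 hN)]
    calc b * |I| / 2 * (Y * (t / N)) = t * (b * Y) * (N⁻¹ * (|I| / 2)) := by
          rw [div_eq_mul_inv t N]; ring
      _ ≤ _ := by gcongr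
  have herr2 : (t * (CE * Y * (A / N)) + (3 * ‖ξ‖ * t ^ 2 + 16 / N) * (Z * C)) * (16 / N)
      ≤ b * |I| / 4 * (Y * (t / N)) := by
    have h1 : A / N ≤ δ := by rw [div_le_iff₀ hN]; linarith
    have h2 : 16 * (16 * C) / N ≤ b * |I| / 8 * t := by
      rw [div_le_iff₀ hN]
      refine hK2.trans ?_
      rw [mul_assoc, mul_comm t N]
      gcongr
    calc (t * (CE * Y * (A / N)) + (3 * ‖ξ‖ * t ^ 2 + 16 / N) * (Z * C)) * (16 / N)
        = (t * (CE * Y * (A / N)) + (3 * (‖ξ‖ * t) * t + 16 / N) * (Z * C)) * (16 / N) := by ring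
      _ ≤ (t * (CE * Y * δ) + (3 * δ * t + 16 / N) * (Y * C)) * (16 / N) := by gcongr
      _ = (16 * (CE * δ + 3 * C * δ) * t + 16 * (16 * C) / N) * (Y / N) := by ring
      _ ≤ (b * |I| / 8 * t + b * |I| / 8 * t) * (Y / N) := by gcongr
      _ = _ := by ring
  have hsub := norm_sub_norm_le (((t * Z * N⁻¹ • I' : ℝ) : ℂ)) J
  rw [norm_sub_rev] at hsub
  have heq : b * |I| / 2 * (Y * (t / N))
      = b * |I| / 4 * (Y * (t / N)) + b * |I| / 4 * (Y * (t / N)) := by ring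
  linarith

end Duhamel

section Weight

lemma rpow_sq_mul_pow {m : ℝ} (hm : 0 < m) (d : ℕ) (s : ℝ) :
    (m ^ 2) ^ s * m ^ d = (m ^ ((d : ℝ) / 2 + s)) ^ 2 := by
  rw [← rpow_natCast m 2, ← rpow_mul hm.le, ← rpow_natCast m d, ← rpow_add hm,
    ← rpow_natCast _ 2, ← rpow_mul hm.le]
  congr 1
  push_cast
  ring

lemma exists_rpow_le_one_add_sq_rpow {δ : ℝ} (hδ : 0 < δ) (hδ1 : δ ≤ 1) (s : ℝ) :
    ∃ c : ℝ, 0 < c ∧ ∀ m r : ℝ, 1 ≤ m → δ / 2 * m ≤ r → r ≤ δ * m →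
      c * (m ^ 2) ^ s ≤ (1 + r ^ 2) ^ s := by
  rcases le_total 0 s with hs | hs
  · refine ⟨((δ / 2) ^ 2) ^ s, by positivity, fun m r hm h1 _ => ?_⟩
    rw [← mul_rpow (by positivity) (by positivity), ← mul_pow]
    have h2 : (δ / 2 * m) ^ 2 ≤ r ^ 2 := by gcongr
    exact rpow_le_rpow (by positivity) (by linarith) hs
  · refine ⟨2 ^ s, by positivity, fun m r hm h1 h2 => ?_⟩
    rw [← mul_rpow (by positivity) (by positivity)]
    have h0 : 0 ≤ r := le_trans (by positivity) h1
    have h3 : r ≤ m := h2.trans (mul_le_of_le_one_left (by linarith) hδ1)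
    exact rpow_le_rpow_of_nonpos (by positivity) (by nlinarith) hs

lemma exists_power_le_lintegral_weight {d : ℕ} (hd : 1 ≤ d) (s : ℝ) {δ : ℝ} (hδ : 0 < δ)
    (hδ1 : δ ≤ 1) :
    ∃ c : ℝ, 0 < c ∧ ∀ m : ℝ, 1 ≤ m →
      ENNReal.ofReal (c * (m ^ ((d : ℝ) / 2 + s)) ^ 2)
        ≤ ∫⁻ ξ in {ξ : Edim d | ξ ≠ 0 ∧ ‖ξ‖ ≤ δ * m}, ENNReal.ofReal ((1 + ‖ξ‖ ^ 2) ^ s) := by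
  obtain ⟨c, hc, h⟩ := exists_rpow_le_one_add_sq_rpow hδ hδ1 s
  set κ : ℝ := (volume (Metric.ball (0 : Edim d) 1)).toReal with hκ
  have hκ0 : 0 < κ := ENNReal.toReal_pos (Metric.measure_ball_pos _ _ one_pos).ne'
    measure_ball_lt_top.ne
  refine ⟨c * ((δ / 4) ^ d * κ), by positivity, fun m hm => ?_⟩
  have hm0 : 0 < m := by linarith
  set x : Edim d := EuclideanSpace.single ⟨0, hd⟩ (3 / 4 * (δ * m)) with hx
  have hxn : ‖x‖ = 3 / 4 * (δ * m) := by
    rw [hx, PiLp.norm_single, Real.norm_of_nonneg (by positivity)]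
  have hball (ξ : Edim d) (hξ : ξ ∈ Metric.ball x (δ / 4 * m)) :
      δ / 2 * m ≤ ‖ξ‖ ∧ ‖ξ‖ ≤ δ * m := by
    have h1 := (abs_norm_sub_norm_le ξ x).trans (mem_ball_iff_norm.1 hξ).le
    rw [hxn, abs_le] at h1
    constructor <;> linarith
  calc ENNReal.ofReal (c * ((δ / 4) ^ d * κ) * (m ^ ((d : ℝ) / 2 + s)) ^ 2)
      = ENNReal.ofReal (c * (m ^ 2) ^ s) * volume (Metric.ball x (δ / 4 * m)) := by
        rw [Measure.addHaar_ball_of_pos _ _ (by positivity), finrank_euclideanSpace_fin,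
          ← ENNReal.ofReal_toReal (measure_ball_lt_top (x := (0 : Edim d))).ne, ← hκ,
          ← ENNReal.ofReal_mul (by positivity), ← ENNReal.ofReal_mul (by positivity),
          ← rpow_sq_mul_pow hm0, mul_pow]
        congr 1
        ring
    _ ≤ ∫⁻ ξ in Metric.ball x (δ / 4 * m), ENNReal.ofReal ((1 + ‖ξ‖ ^ 2) ^ s) := by
        rw [← setLIntegral_const]
        exact setLIntegral_mono' measurableSet_ball fun ξ hξ =>
          ENNReal.ofReal_le_ofReal (h m _ hm (hball ξ hξ).1 (hball ξ hξ).2)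
    _ ≤ _ := by
        refine lintegral_mono_set fun ξ hξ => ⟨?_, (hball ξ hξ).2⟩
        exact norm_pos_iff.1 (lt_of_lt_of_le (by positivity) (hball ξ hξ).1)

lemma integral_shell_norm_pow_inv {d : ℕ} (hd : 1 ≤ d) {a b : ℝ} (ha : 0 < a) (hab : a ≤ b) :
    ∫ ξ : Edim d, (Icc a b).indicator (fun y => (y ^ d)⁻¹) ‖ξ‖
      = d * (volume.real (Metric.ball (0 : Edim d) 1) * log (b / a)) := by
  have : Nontrivial (Edim d) :=
    Module.nontrivial_of_finrank_pos (R := ℝ) (by rw [finrank_euclideanSpace_fin]; exact hd)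
  rw [integral_fun_norm_addHaar volume ((Icc a b).indicator fun y => (y ^ d)⁻¹),
    finrank_euclideanSpace_fin, nsmul_eq_mul, smul_eq_mul]
  congr 2
  have h (y : ℝ) : y ^ (d - 1) • (Icc a b).indicator (fun y => (y ^ d)⁻¹) y
      = (Icc a b).indicator (fun y => y⁻¹) y := by
    by_cases hy : y ∈ Icc a b
    · have hy0 : y ≠ 0 := (ha.trans_le hy.1).ne'
      rw [indicator_of_mem hy, indicator_of_mem hy, smul_eq_mul]
      obtain ⟨n, rfl⟩ : ∃ n, d = n + 1 := ⟨d - 1, by omega⟩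
      rw [Nat.add_sub_cancel, pow_succ]
      field_simp
    · rw [indicator_of_notMem hy, indicator_of_notMem hy, smul_zero]
  simp_rw [h]
  rw [setIntegral_indicator measurableSet_Icc,
    inter_eq_self_of_subset_right (show Icc a b ⊆ Ioi 0 from fun y hy => ha.trans_le hy.1),
     integral_Icc_eq_integral_Ioc,
    ← intervalIntegral.integral_of_le hab, integral_inv_of_pos ha (ha.trans_le hab)]

lemma exists_log_le_lintegral_weight {d : ℕ} (hd : 1 ≤ d) {δ : ℝ} (hδ : 0 < δ) :
    ∃ c : ℝ, 0 < c ∧ ∀ m : ℝ, 1 ≤ m →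
      ENNReal.ofReal (c * log (2 * m))
        ≤ ∫⁻ ξ in {ξ : Edim d | ξ ≠ 0 ∧ ‖ξ‖ ≤ δ * m},
          ENNReal.ofReal ((1 + ‖ξ‖ ^ 2) ^ (-(d : ℝ) / 2)) := by
  set κ : ℝ := volume.real (Metric.ball (0 : Edim d) 1) with hκ
  have hκ0 : 0 < κ := ENNReal.toReal_pos (Metric.measure_ball_pos _ _ one_pos).ne'
    measure_ball_lt_top.ne
  have hd0 : (0 : ℝ) < d := by exact_mod_cast hd
  set q : ℝ := (1 + 4 / δ ^ 2) ^ (-(d : ℝ) / 2) with hq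
  have hq0 : 0 < q := by positivity
  refine ⟨q * (d * κ), by positivity, fun m hm => ?_⟩
  have hm0 : 0 < m := by linarith
  have hab : δ / 2 ≤ δ * m := by nlinarith
  set f : Edim d → ℝ := fun ξ => (Icc (δ / 2) (δ * m)).indicator (fun y => (y ^ d)⁻¹) ‖ξ‖ with hf
  have hfint : ∫ ξ, f ξ = d * (κ * log (2 * m)) := by
    rw [hf, integral_shell_norm_pow_inv hd (by positivity) hab, ← hκ]
    congr 3
    field_simp
  have hlog : 0 < log (2 * m) := log_pos (by linarith)
  have hfi : Integrable f := .of_integral_ne_zero (by rw [hfint]; positivity)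
  have hf0 (ξ : Edim d) : 0 ≤ f ξ :=
    indicator_nonneg (fun y hy => inv_nonneg.2 (pow_nonneg (le_trans (by positivity) hy.1) _)) _
  have hle (ξ : Edim d) : ENNReal.ofReal (q * f ξ) ≤
      {ξ : Edim d | ξ ≠ 0 ∧ ‖ξ‖ ≤ δ * m}.indicator
        (fun ξ => ENNReal.ofReal ((1 + ‖ξ‖ ^ 2) ^ (-(d : ℝ) / 2))) ξ := by
    by_cases hξ : ‖ξ‖ ∈ Icc (δ / 2) (δ * m)
    · have hr : 0 < ‖ξ‖ := lt_of_lt_of_le (by positivity) hξ.1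
      rw [indicator_of_mem (show ξ ∈ {ξ : Edim d | ξ ≠ 0 ∧ ‖ξ‖ ≤ δ * m} from
        ⟨norm_pos_iff.1 hr, hξ.2⟩)]
      refine ENNReal.ofReal_le_ofReal ?_
      have h1 : (‖ξ‖ ^ d)⁻¹ = (‖ξ‖ ^ 2) ^ (-(d : ℝ) / 2) := by
        rw [← rpow_natCast ‖ξ‖ 2, ← rpow_mul hr.le, ← rpow_natCast, ← rpow_neg hr.le]
        congr 1
        push_cast
        ring
      have h2 : 1 ≤ 4 / δ ^ 2 * ‖ξ‖ ^ 2 := by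
        rw [div_mul_eq_mul_div, le_div_iff₀ (by positivity)]
        nlinarith [hξ.1]
      simp only [hf]
      rw [indicator_of_mem hξ, h1, hq, ← mul_rpow (by positivity) (by positivity)]
      exact rpow_le_rpow_of_nonpos (by positivity) (by linarith)
        (div_nonpos_of_nonpos_of_nonneg (by linarith) zero_le_two)
    · simp only [hf]
      rw [indicator_of_notMem hξ, mul_zero, ENNReal.ofReal_zero]
      exact zero_le
  have hmeas : MeasurableSet {ξ : Edim d | ξ ≠ 0 ∧ ‖ξ‖ ≤ δ * m} :=
    (measurableSet_singleton 0).compl.inter (measurableSet_le measurable_norm measurable_const)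
  rw [← lintegral_indicator hmeas]
  refine le_trans (le_of_eq ?_) (lintegral_mono hle)
  rw [← ofReal_integral_eq_lintegral_ofReal (hfi.const_mul q)
    (ae_of_all _ fun ξ => mul_nonneg hq0.le (hf0 ξ)), integral_const_mul, hfint]
  congr 1
  ring

lemma exists_gs_sq_le_lintegral_weight {d : ℕ} (hd : 1 ≤ d) (s : ℝ) {δ : ℝ} (hδ : 0 < δ)
    (hδ1 : δ ≤ 1) :
    ∃ c : ℝ, 0 < c ∧ ∀ m : ℝ, 1 ≤ m →
      ENNReal.ofReal (c * gs d s m ^ 2)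
        ≤ ∫⁻ ξ in {ξ : Edim d | ξ ≠ 0 ∧ ‖ξ‖ ≤ δ * m}, ENNReal.ofReal ((1 + ‖ξ‖ ^ 2) ^ s) := by
  rcases lt_trichotomy s (-(d : ℝ) / 2) with hs | rfl | hs
  · obtain ⟨c, hc, h⟩ := exists_power_le_lintegral_weight hd s hδ hδ1
    refine ⟨c, hc, fun m hm => ?_⟩
    have h1 := h 1 le_rfl
    rw [one_rpow] at h1
    rw [gs, if_pos hs]
    refine h1.trans (lintegral_mono_set fun ξ hξ => ⟨hξ.1, hξ.2.trans ?_⟩)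
    gcongr
  · obtain ⟨c, hc, h⟩ := exists_log_le_lintegral_weight hd hδ
    refine ⟨c, hc, fun m hm => le_trans (ENNReal.ofReal_le_ofReal ?_) (h m hm)⟩
    rw [gs, if_neg (lt_irrefl _), if_pos rfl, sq_sqrt (log_nonneg (one_le_sqrt.2 (by nlinarith)))]
    gcongr
    rw [sqrt_le_left (by positivity)]
    nlinarith
  · obtain ⟨c, hc, h⟩ := exists_power_le_lintegral_weight hd s hδ hδ1
    refine ⟨c, hc, fun m hm => ?_⟩
    rw [gs, if_neg hs.not_gt, if_neg hs.ne']
    exact h m hm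

lemma gs_nonneg (d : ℕ) (s : ℝ) {m : ℝ} (hm : 0 ≤ m) : 0 ≤ gs d s m := by
  rw [gs]
  split_ifs <;> positivity

lemma ofReal_mul_le_HsNorm {d : ℕ} {s L w : ℝ} (hL : 0 ≤ L) (hw : 0 ≤ w) {S : Set (Edim d)}
    {F : Edim d → ℂ} (hS : MeasurableSet S) (hF : ∀ ξ ∈ S, L ≤ ‖F ξ‖)
    (hwS : ENNReal.ofReal (w ^ 2) ≤ ∫⁻ ξ in S, ENNReal.ofReal ((1 + ‖ξ‖ ^ 2) ^ s)) :
    ENNReal.ofReal (L * w) ≤ HsNorm d s F := by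
  have h : ENNReal.ofReal ((L * w) ^ 2) ≤ HsNormSq d s F := by
    calc ENNReal.ofReal ((L * w) ^ 2)
        ≤ ENNReal.ofReal (L ^ 2) * ∫⁻ ξ in S, ENNReal.ofReal ((1 + ‖ξ‖ ^ 2) ^ s) := by
          rw [mul_pow, ENNReal.ofReal_mul (by positivity)]
          gcongr
      _ = ∫⁻ ξ in S, ENNReal.ofReal (L ^ 2) * ENNReal.ofReal ((1 + ‖ξ‖ ^ 2) ^ s) :=
          (lintegral_const_mul' _ _ ENNReal.ofReal_ne_top).symm
      _ ≤ ∫⁻ ξ in S, ENNReal.ofReal ((1 + ‖ξ‖ ^ 2) ^ s * ‖F ξ‖ ^ 2) := by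
          refine setLIntegral_mono' hS fun ξ hξ => ?_
          rw [← ENNReal.ofReal_mul (by positivity), mul_comm]
          have := hF ξ hξ
          gcongr
      _ ≤ HsNormSq d s F := setLIntegral_le_lintegral _ _
  have h2 := ENNReal.rpow_le_rpow h (by norm_num : (0 : ℝ) ≤ 1 / 2)
  rwa [ENNReal.ofReal_rpow_of_nonneg (by positivity) (by norm_num), ← sqrt_eq_rpow,
    sqrt_sq (by positivity)] at h2

end Weight

/-- Proposition 4.2: for `2 ≤ k ≤ 5` and any `s ∈ ℝ`, the lower bound
`‖Ξ₁(φ⃗)(t)‖_{H^s} ≳ R^k (t/N) A^{(k-1)d} min(g_s(A), g_s(1/t))` for `1 ≤ A ≪ N` and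
`N⁻¹ ≪ t ≲ 1`, where `φ̂ = R·𝟙_{Ω_k}` and `φ⃗ = (φ,0)`. -/
theorem Xi1_lower_bound_long_time
    (d k : ℕ) (hd : 1 ≤ d) (hk2 : 2 ≤ k) (hk5 : k ≤ 5) (s : ℝ) :
    ∃ c δ K : ℝ, 0 < c ∧ 0 < δ ∧ 0 < K ∧
      ∀ A N R t : ℝ, 1 ≤ A → A / δ ≤ N → 0 < R → K / N ≤ t → t ≤ δ →
        ENNReal.ofReal (c * R ^ k * (t / N) * A ^ ((k - 1) * d) *
            min (gs d s A) (gs d s (1 / t))) ≤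
          HsNorm d s (Xi d k (phiHatK d k N A R) (fun _ => 0) 1 t) := by
  obtain ⟨c₁, δ, K, hc₁, hδ, hδ1, hK, hXi⟩ := exists_Xi_one_lower_bound hd hk2 hk5
  obtain ⟨c₂, hc₂, hweight⟩ := exists_gs_sq_le_lintegral_weight hd s hδ hδ1
  refine ⟨c₁ * √c₂, δ, K, by positivity, hδ, hK, fun A N R t hA hAN hR hKt htδ => ?_⟩
  have hN : 0 < N := (by positivity : 0 < A / δ).trans_le hAN
  have ht : 0 < t := (by positivity : 0 < K / N).trans_le hKt
  have hm : 1 ≤ min A (1 / t) := le_min hA ((one_le_div ht).2 (htδ.trans hδ1))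
  have hgs : min (gs d s A) (gs d s (1 / t)) ≤ gs d s (min A (1 / t)) := by
    rcases min_choice A (1 / t) with h | h <;> rw [h]
    · exact min_le_left _ _
    · exact min_le_right _ _
  have hgs0 := gs_nonneg d s (zero_le_one.trans hm)
  have hmeas : MeasurableSet {ξ : Edim d | ξ ≠ 0 ∧ ‖ξ‖ ≤ δ * min A (1 / t)} :=
    (measurableSet_singleton 0).compl.inter (measurableSet_le measurable_norm measurable_const)
  have hA0 : 0 < A := by linarith
  refine le_trans (ENNReal.ofReal_le_ofReal ?_)
    (ofReal_mul_le_HsNorm (L := c₁ * (R ^ k * (A ^ d) ^ (k - 1) * (t / N)))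
      (w := √c₂ * gs d s (min A (1 / t))) (by positivity) (by positivity) hmeas
      (fun ξ hξ => hXi A N R t hA hAN hR hKt ξ hξ.1 (hξ.2.trans ?_) ?_) ?_)
  · calc c₁ * √c₂ * R ^ k * (t / N) * A ^ ((k - 1) * d) * min (gs d s A) (gs d s (1 / t))
        ≤ c₁ * √c₂ * R ^ k * (t / N) * A ^ ((k - 1) * d) * gs d s (min A (1 / t)) := by gcongr
      _ = _ := by
        rw [mul_comm (k - 1) d, pow_mul]
        ring
  · gcongr
    exact min_le_left _ _
  · have h : ‖ξ‖ ≤ δ * (1 / t) := hξ.2.trans (by gcongr; exact min_le_right _ _)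
    rwa [mul_one_div, le_div_iff₀ ht] at h
  · rw [mul_pow, sq_sqrt hc₂.le]
    exact hweight _ hm

end
end

section
/- Let d ≥ 1 and let k be an integer with 2 ≤ k ≤ 5. There exist constants c, C, δ > 0, depending only on d and k, such that the following holds for all N ≥ 1 and 1 ≤ A ≤ δN. For all ξ₁, …, ξ_k ∈ Ω_k whose sum ξ := ξ₁ + ⋯ + ξ_k lies in Q_A, writing ξ̄ = (ξ₁,…,ξ_k), one has c/N ≤ Σ_{ε̄ ∈ {±1}^k} I(ξ̄, ε̄) ≤ C/N, where for ε̄ = (ε₁,…,ε_k) ∈ {±1}^k we set Φ(ξ̄) := |ξ| − Σ_{j=1}^k |ξ_j|, Ψ(ξ̄,ε̄) := Σ_{j=1}^k ε_j|ξ_j|, S(ε̄) := Σ_{j=1}^k ε_j, and I(ξ̄,ε̄) := −( 2Φ(ξ̄)·cos(S(ε̄)π/6) − 2√3·Ψ(ξ̄,ε̄)·sin(S(ε̄)π/6) ) / ( Φ(ξ̄)² + 3Ψ(ξ̄,ε̄)² ). -/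
open MeasureTheory Real Set Filter Topology
open scoped ENNReal NNReal BigOperators

noncomputable section

/-- The quantity `I(ξ̄, ε̄)` of Lemma 4.3:
`I(ξ̄,ε̄) = -(2Φ(ξ̄)cos(S(ε̄)π/6) - 2√3 Ψ(ξ̄,ε̄) sin(S(ε̄)π/6)) / (Φ(ξ̄)² + 3Ψ(ξ̄,ε̄)²)`,
with `Φ(ξ̄) = |ξ₁+⋯+ξ_k| - Σ|ξ_j|`, `Ψ(ξ̄,ε̄) = Σ ε_j|ξ_j|`, `S(ε̄) = Σ ε_j`. -/
def Ifun (d k : ℕ) (ξv : Fin k → Edim d) (εv : Fin k → ℝ) : ℝ :=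
  -((2 * (‖∑ j, ξv j‖ - ∑ j, ‖ξv j‖) * Real.cos ((∑ j, εv j) * π / 6) -
        2 * Real.sqrt 3 * (∑ j, εv j * ‖ξv j‖) * Real.sin ((∑ j, εv j) * π / 6)) /
      ((‖∑ j, ξv j‖ - ∑ j, ‖ξv j‖) ^ 2 + 3 * (∑ j, εv j * ‖ξv j‖) ^ 2))

/-- Up to sign, the numerator of `I(ξ̄, ε̄)`, as a function of `P = -Φ`, `Q = Ψ` and `S`. -/
def phaseNumerator (P Q S : ℝ) : ℝ :=
  2 * P * Real.cos (S * π / 6) + 2 * √3 * Q * Real.sin (S * π / 6)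

theorem phaseNumerator_neg (P Q S : ℝ) :
    phaseNumerator P (-Q) (-S) = phaseNumerator P Q S := by
  have h : -S * π / 6 = -(S * π / 6) := by ring
  simp only [phaseNumerator, h, Real.cos_neg, Real.sin_neg]
  ring

theorem phaseNumerator_zero (P Q : ℝ) : phaseNumerator P Q 0 = 2 * P := by
  simp [phaseNumerator]

theorem phaseNumerator_one (P Q : ℝ) : phaseNumerator P Q 1 = √3 * (P + Q) := by
  rw [phaseNumerator, one_mul, Real.cos_pi_div_six, Real.sin_pi_div_six]
  ring

theorem phaseNumerator_two (P Q : ℝ) : phaseNumerator P Q 2 = P + 3 * Q := by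
  have h : (2 : ℝ) * π / 6 = π / 3 := by ring
  rw [phaseNumerator, h, Real.cos_pi_div_three, Real.sin_pi_div_three]
  linear_combination Q * Real.sq_sqrt (show (0 : ℝ) ≤ 3 by norm_num)

theorem phaseNumerator_three (P Q : ℝ) : phaseNumerator P Q 3 = 2 * √3 * Q := by
  have h : (3 : ℝ) * π / 6 = π / 2 := by ring
  rw [phaseNumerator, h, Real.cos_pi_div_two, Real.sin_pi_div_two]
  ring

theorem phaseNumerator_four (P Q : ℝ) : phaseNumerator P Q 4 = 3 * Q - P := by
  have h : (4 : ℝ) * π / 6 = π - π / 3 := by ring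
  rw [phaseNumerator, h, Real.cos_pi_sub, Real.sin_pi_sub, Real.cos_pi_div_three,
    Real.sin_pi_div_three]
  linear_combination Q * Real.sq_sqrt (show (0 : ℝ) ≤ 3 by norm_num)

theorem phaseNumerator_five (P Q : ℝ) : phaseNumerator P Q 5 = √3 * (Q - P) := by
  have h : (5 : ℝ) * π / 6 = π - π / 6 := by ring
  rw [phaseNumerator, h, Real.cos_pi_sub, Real.sin_pi_sub, Real.cos_pi_div_six,
    Real.sin_pi_div_six]
  ring

/-- A sufficient condition for nonnegativity when `S ∈ {0, …, 5}`. -/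
theorem phaseNumerator_nonneg_of {P Q S : ℝ}
    (h : S = 0 ∧ 0 ≤ P ∨ S = 1 ∧ 0 ≤ P + Q ∨ S = 2 ∧ 0 ≤ P + 3 * Q ∨ S = 3 ∧ 0 ≤ Q ∨
      S = 4 ∧ P ≤ 3 * Q ∨ S = 5 ∧ P ≤ Q) : 0 ≤ phaseNumerator P Q S := by
  have h3 : 0 ≤ √3 := Real.sqrt_nonneg 3
  rcases h with ⟨rfl, h⟩ | ⟨rfl, h⟩ | ⟨rfl, h⟩ | ⟨rfl, h⟩ | ⟨rfl, h⟩ | ⟨rfl, h⟩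
  · rw [phaseNumerator_zero]; linarith
  · rw [phaseNumerator_one]; positivity
  · rwa [phaseNumerator_two]
  · rw [phaseNumerator_three]; positivity
  · rw [phaseNumerator_four]; linarith
  · rw [phaseNumerator_five]; exact mul_nonneg h3 (by linarith)

set_option maxHeartbeats 1600000 in
/-- Nonnegativity for `k` inputs of size comparable to `N` and output of size `x ≪ N`. -/
theorem phaseNumerator_sum_nonneg {k : ℕ} (hk2 : 2 ≤ k) (hk5 : k ≤ 5) {N x : ℝ}
    {r : Fin k → ℝ} (hN : 0 < N) (hx0 : 0 ≤ x) (hx : x ≤ N / 16)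
    (hlo : ∀ j, 15 / 16 * N ≤ r j) (hhi : ∀ j, r j ≤ 33 / 16 * N)
    (heven : k % 2 = 0 → ∀ j, r j ≤ 17 / 16 * N) {e : Fin k → ℝ}
    (he : ∀ j, e j = 1 ∨ e j = -1) :
    0 ≤ phaseNumerator (∑ j, r j - x) (∑ j, e j * r j) (∑ j, e j) := by
  interval_cases k
  · have hup := heven rfl
    simp only [Fin.sum_univ_two]
    have l0 := hlo 0
    have u0 := hup 0
    have l1 := hlo 1
    have u1 := hup 1
    rcases he 0 with h0 | h0 <;> rcases he 1 with h1 | h1 <;>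
      rw [h0, h1] <;>
      first
      | (refine phaseNumerator_nonneg_of ?_; norm_num; linarith)
      | (rw [← phaseNumerator_neg]; refine phaseNumerator_nonneg_of ?_; norm_num; linarith)
  · have hup := hhi
    simp only [Fin.sum_univ_three]
    have l0 := hlo 0
    have u0 := hup 0
    have l1 := hlo 1
    have u1 := hup 1
    have l2 := hlo 2
    have u2 := hup 2
    rcases he 0 with h0 | h0 <;> rcases he 1 with h1 | h1 <;> rcases he 2 with h2 | h2 <;>
      rw [h0, h1, h2] <;>
      first
      | (refine phaseNumerator_nonneg_of ?_; norm_num; linarith)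
      | (rw [← phaseNumerator_neg]; refine phaseNumerator_nonneg_of ?_; norm_num; linarith)
  · have hup := heven rfl
    simp only [Fin.sum_univ_four]
    have l0 := hlo 0
    have u0 := hup 0
    have l1 := hlo 1
    have u1 := hup 1
    have l2 := hlo 2
    have u2 := hup 2
    have l3 := hlo 3
    have u3 := hup 3
    rcases he 0 with h0 | h0 <;> rcases he 1 with h1 | h1 <;> rcases he 2 with h2 | h2 <;>
      rcases he 3 with h3 | h3 <;>
      rw [h0, h1, h2, h3] <;>
      first
      | (refine phaseNumerator_nonneg_of ?_; norm_num; linarith)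
      | (rw [← phaseNumerator_neg]; refine phaseNumerator_nonneg_of ?_; norm_num; linarith)
  · have hup := hhi
    simp only [Fin.sum_univ_five]
    have l0 := hlo 0
    have u0 := hup 0
    have l1 := hlo 1
    have u1 := hup 1
    have l2 := hlo 2
    have u2 := hup 2
    have l3 := hlo 3
    have u3 := hup 3
    have l4 := hlo 4
    have u4 := hup 4
    rcases he 0 with h0 | h0 <;> rcases he 1 with h1 | h1 <;> rcases he 2 with h2 | h2 <;>
      rcases he 3 with h3 | h3 <;> rcases he 4 with h4 | h4 <;>
      rw [h0, h1, h2, h3, h4] <;>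
      first
      | (refine phaseNumerator_nonneg_of ?_; norm_num; linarith)
      | (rw [← phaseNumerator_neg]; refine phaseNumerator_nonneg_of ?_; norm_num; linarith)

/-- Some choice of signs makes the numerator at least of size `N`. -/
theorem exists_le_phaseNumerator_sum {k : ℕ} (hk2 : 2 ≤ k) (hk5 : k ≤ 5) {N x : ℝ}
    {r : Fin k → ℝ} (hN : 0 < N) (hx : x ≤ N / 16)
    (hlo : ∀ j, 15 / 16 * N ≤ r j) (hhi : ∀ j, r j ≤ 33 / 16 * N) :
    ∃ ε : Fin k → Bool, N ≤ phaseNumerator (∑ j, r j - x)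
      (∑ j, (if ε j then 1 else -1) * r j) (∑ j, if ε j then 1 else -1) := by
  have h3 : 1 ≤ √3 := Real.one_le_sqrt.mpr (by norm_num)
  have hthree {P Q S : ℝ} (hS : S = 3) (hQ : N ≤ Q) : N ≤ phaseNumerator P Q S := by
    rw [hS, phaseNumerator_three]
    nlinarith
  have hzero {P Q S : ℝ} (hS : S = 0) (hP : N ≤ P) : N ≤ phaseNumerator P Q S := by
    rw [hS, phaseNumerator_zero]
    linarith
  interval_cases k
  · refine ⟨![true, false], hzero (by simp) ?_⟩
    simp only [Fin.sum_univ_two]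
    linarith [hlo 0, hlo 1]
  · refine ⟨fun _ => true, hthree (by simp) ?_⟩
    simp only [Fin.sum_univ_three, if_true]
    linarith [hlo 0, hlo 1, hlo 2]
  · refine ⟨![true, true, false, false], hzero (by simp [Fin.sum_univ_four]) ?_⟩
    simp only [Fin.sum_univ_four]
    linarith [hlo 0, hlo 1, hlo 2, hlo 3]
  · refine ⟨![true, true, true, true, false],
      hthree (by simp [Fin.sum_univ_five]; norm_num) ?_⟩
    simp [Fin.sum_univ_five]
    linarith [hlo 0, hlo 1, hlo 2, hlo 3, hhi 4]

theorem Ifun_eq_phaseNumerator_div (d k : ℕ) (ξv : Fin k → Edim d) (e : Fin k → ℝ) :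
    Ifun d k ξv e =
      phaseNumerator (∑ j, ‖ξv j‖ - ‖∑ j, ξv j‖) (∑ j, e j * ‖ξv j‖) (∑ j, e j) /
        ((∑ j, ‖ξv j‖ - ‖∑ j, ξv j‖) ^ 2 + 3 * (∑ j, e j * ‖ξv j‖) ^ 2) := by
  rw [Ifun, phaseNumerator, ← neg_div]
  congr 1 <;> ring

theorem phaseNumerator_div_le {P : ℝ} (hP : 0 < P) (Q S : ℝ) :
    phaseNumerator P Q S / (P ^ 2 + 3 * Q ^ 2) ≤ 4 / P := by
  have h3 : √3 ^ 2 = 3 := Real.sq_sqrt (by norm_num)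
  have hs : √3 * Q * Real.sin (S * π / 6) ≤ |√3 * Q| :=
    (le_abs_self _).trans (by
      rw [abs_mul]
      exact mul_le_of_le_one_right (abs_nonneg _) (Real.abs_sin_le_one _))
  have hc : P * Real.cos (S * π / 6) ≤ P :=
    mul_le_of_le_one_right hP.le (Real.cos_le_one _)
  have hnum : phaseNumerator P Q S ≤ 2 * P + 2 * |√3 * Q| := by
    rw [phaseNumerator]
    linarith
  have hsq : 3 * Q ^ 2 = |√3 * Q| ^ 2 := by rw [sq_abs, mul_pow, h3]
  rw [hsq, div_le_div_iff₀ (by positivity) hP]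
  nlinarith [sq_nonneg (P - |√3 * Q|), sq_nonneg (|√3 * Q|)]

theorem EuclideanSpace.norm_le_card_mul {d : ℕ} (hd : 1 ≤ d) {a : ℝ} (ha : 0 ≤ a)
    {v : Edim d} (hv : ∀ i, |v i| ≤ a) : ‖v‖ ≤ d * a := by
  have hd' : (1 : ℝ) ≤ d := by exact_mod_cast hd
  refine (sq_le_sq₀ (norm_nonneg v) (by positivity)).1 ?_
  calc ‖v‖ ^ 2 = ∑ i, |v i| ^ 2 := by simp [EuclideanSpace.norm_sq_eq]
    _ ≤ ∑ _i : Fin d, a ^ 2 := by gcongr with i; exact hv i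
    _ = d * a ^ 2 := by simp
    _ ≤ (d * a) ^ 2 := by nlinarith [sq_nonneg a, mul_nonneg (sub_nonneg.2 hd') (sq_nonneg a)]

/-- Points of `Ω_k` have norm close to that of one of its centres. -/
theorem norm_bounds_of_mem_OmegaKSet {d k : ℕ} (hd : 1 ≤ d) {N A : ℝ} (hN : 0 < N)
    (hA : 0 ≤ A) {ξ : Edim d} (hξ : ξ ∈ OmegaKSet d k N A) :
    N - d * (A / 8) ≤ ‖ξ‖ ∧ ‖ξ‖ ≤ 2 * N + d * (A / 8) ∧
      (k % 2 = 0 → ‖ξ‖ ≤ N + d * (A / 8)) := by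
  obtain ⟨c, hc, hξ⟩ := hξ
  have hdist : ‖ξ - EuclideanSpace.single ⟨0, hd⟩ c‖ ≤ d * (A / 8) := by
    refine EuclideanSpace.norm_le_card_mul hd (by positivity) fun i => ?_
    have h := hξ i
    simpa [Pi.single_apply, Fin.ext_iff] using h
  have habs := (abs_le.1 ((abs_norm_sub_norm_le _ _).trans hdist))
  rw [PiLp.norm_single, Real.norm_eq_abs] at habs
  split_ifs at hc with hk
  · have hcN : |c| = N := by
      rcases hc with rfl | rfl <;> simp [abs_of_pos hN]
    rw [hcN] at habs
    exact ⟨by linarith, by linarith, fun _ => by linarith⟩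
  · have hcN : |c| = N ∨ |c| = 2 * N := by
      rcases hc with rfl | rfl | rfl | rfl <;> simp [abs_mul, abs_of_pos hN]
    refine ⟨?_, ?_, fun h => absurd h hk⟩ <;> rcases hcN with h | h <;> rw [h] at habs <;>
      linarith

/-- Lemma 4.3: for `2 ≤ k ≤ 5`, `1 ≤ A ≪ N`, and `ξ₁,…,ξ_k ∈ Ω_k`
with `ξ₁+⋯+ξ_k ∈ Q_A`, one has `Σ_{ε̄∈{±1}^k} I(ξ̄,ε̄) ∼ 1/N`. -/
theorem sum_Ifun_comparable
    (d k : ℕ) (hd : 1 ≤ d) (hk2 : 2 ≤ k) (hk5 : k ≤ 5) :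
    ∃ c C δ : ℝ, 0 < c ∧ 0 < C ∧ 0 < δ ∧
      ∀ N A : ℝ, 1 ≤ N → 1 ≤ A → A ≤ δ * N →
        ∀ ξv : Fin k → Edim d, (∀ j, ξv j ∈ OmegaKSet d k N A) →
          (∑ j, ξv j) ∈ cubeSet d A →
          c / N ≤ (∑ ε : Fin k → Bool, Ifun d k ξv fun j => if ε j then 1 else -1) ∧
          (∑ ε : Fin k → Bool, Ifun d k ξv fun j => if ε j then 1 else -1) ≤ C / N := by
  have hd' : (1 : ℝ) ≤ d := by exact_mod_cast hd
  refine ⟨1 / 500, 2 ^ k * 4, 1 / (2 * d), by norm_num, by positivity, by positivity, ?_⟩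
  intro N A hN1 hA1 hAN ξv hξ hsum
  have hN : 0 < N := by linarith
  have hdA : d * (A / 8) ≤ N / 16 := by
    have h := mul_le_mul_of_nonneg_left hAN (show (0 : ℝ) ≤ d / 8 by positivity)
    have h' : (d : ℝ) / 8 * (1 / (2 * d) * N) = N / 16 := by field_simp; norm_num
    linarith
  have hnorm := fun j => norm_bounds_of_mem_OmegaKSet hd hN (by linarith) (hξ j)
  have hx : ‖∑ j, ξv j‖ ≤ N / 16 :=
    (EuclideanSpace.norm_le_card_mul hd (by linarith) hsum).trans hdA
  have hlo : ∀ j, 15 / 16 * N ≤ ‖ξv j‖ := fun j => by linarith [(hnorm j).1]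
  have hhi : ∀ j, ‖ξv j‖ ≤ 33 / 16 * N := fun j => by linarith [(hnorm j).2.1]
  have heven : k % 2 = 0 → ∀ j, ‖ξv j‖ ≤ 17 / 16 * N :=
    fun h j => by linarith [(hnorm j).2.2 h]
  have hk2' : (2 : ℝ) ≤ k := by exact_mod_cast hk2
  have hk5' : (k : ℝ) ≤ 5 := by exact_mod_cast hk5
  have hTlo : k * (15 / 16 * N) ≤ ∑ j, ‖ξv j‖ := by
    simpa using Finset.card_nsmul_le_sum Finset.univ (fun j => ‖ξv j‖) _ fun j _ => hlo j
  have hThi : ∑ j, ‖ξv j‖ ≤ k * (33 / 16 * N) := by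
    simpa using Finset.sum_le_card_nsmul Finset.univ (fun j => ‖ξv j‖) _ fun j _ => hhi j
  have hPlo : N ≤ ∑ j, ‖ξv j‖ - ‖∑ j, ξv j‖ := by nlinarith
  have hPhi : ∑ j, ‖ξv j‖ - ‖∑ j, ξv j‖ ≤ 11 * N := by
    nlinarith [norm_nonneg (∑ j, ξv j)]
  have hsign : ∀ (ε : Fin k → Bool) (j : Fin k),
      (if ε j then (1 : ℝ) else -1) = 1 ∨ (if ε j then (1 : ℝ) else -1) = -1 :=
    fun ε j => by cases ε j <;> simp
  simp only [Ifun_eq_phaseNumerator_div]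
  constructor
  · obtain ⟨ε, hε⟩ := exists_le_phaseNumerator_sum hk2 hk5 hN hx hlo hhi
    refine le_trans ?_ (Finset.single_le_sum (fun ε' _ => div_nonneg
      (phaseNumerator_sum_nonneg hk2 hk5 hN (norm_nonneg _) hx hlo hhi heven (hsign ε'))
      (by positivity)) (Finset.mem_univ ε))
    have hQ : |∑ j, (if ε j then (1 : ℝ) else -1) * ‖ξv j‖| ≤ 11 * N := by
      refine (Finset.abs_sum_le_sum_abs _ _).trans ?_
      refine (Finset.sum_le_sum fun j _ => ?_).trans (hThi.trans (by nlinarith))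
      cases ε j <;> simp
    have hQ2 := sq_le_sq' (abs_le.1 hQ).1 (abs_le.1 hQ).2
    have hP2 := pow_le_pow_left₀ (hN.le.trans hPlo) hPhi 2
    rw [div_le_div_iff₀ hN (by nlinarith [sq_nonneg (∑ j, (if ε j then (1 : ℝ) else -1) * ‖ξv j‖)])]
    nlinarith [mul_le_mul_of_nonneg_right hε hN.le]
  · calc _ ≤ ∑ _ε : Fin k → Bool, 4 / N := Finset.sum_le_sum fun ε _ =>
          (phaseNumerator_div_le (hN.trans_le hPlo) _ _).trans (by gcongr)
      _ = 2 ^ k * 4 / N := by simp [mul_div_assoc]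

end
end
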